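/- Let T be a positive operator on a complex Banach lattice E with r(T) = 1, and let e^{iθ} (θ ∈ ℝ) be a peripheral spectral value of T. If limsup_{r↓1} ‖R(re^{iθ}, T)‖ / ‖R(r, T)‖ > 0, then e^{inθ} ∈ σ(T) for each n ∈ ℤ. -/

import Mathlib

open scoped ComplexOrder ENNReal
open Filter Topology

noncomputable section

/-- A complex Banach lattice: a complex Banach space `E = E_ℝ ⊕ i E_ℝ` which is the
complexification of a real Banach lattice `E_ℝ` (the set `real`), equipped with the
partial order induced by the positive cone of `E_ℝ` and with the lattice modulus
`|z| = sup_θ |Re (e^{iθ} z)|` (the map `modulus`), whose norm satisfies `‖z‖ = ‖|z|‖`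
and is a lattice norm. -/
class ComplexBanachLattice (E : Type*) [NormedAddCommGroup E] [NormedSpace ℂ E]
    [PartialOrder E] where
  /-- The real part `E_ℝ` of `E`. -/
  real : Set E
  real_zero : (0 : E) ∈ real
  real_add : ∀ x ∈ real, ∀ y ∈ real, x + y ∈ real
  real_neg : ∀ x ∈ real, -x ∈ real
  real_smul : ∀ (r : ℝ), ∀ x ∈ real, (r : ℂ) • x ∈ real
  /-- `E = E_ℝ ⊕ i E_ℝ`. -/
  real_decomp : ∀ z : E, ∃ x ∈ real, ∃ y ∈ real, z = x + Complex.I • y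
  /-- Positive elements are real. -/
  nonneg_mem_real : ∀ x : E, 0 ≤ x → x ∈ real
  /-- The order is determined by the positive cone. -/
  le_iff_sub_nonneg : ∀ x y : E, x ≤ y ↔ 0 ≤ y - x
  smul_nonneg : ∀ (r : ℝ), 0 ≤ r → ∀ x : E, 0 ≤ x → 0 ≤ (r : ℂ) • x
  /-- The real part is a (vector) lattice: binary suprema of real elements exist. -/
  real_sup_exists : ∀ x ∈ real, ∀ y ∈ real, ∃ s ∈ real, IsLUB {x, y} s
  /-- The modulus map `z ↦ |z|`. -/
  modulus : E → E
  modulus_nonneg : ∀ z : E, 0 ≤ modulus z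
  modulus_eq_zero_iff : ∀ z : E, modulus z = 0 ↔ z = 0
  modulus_add_le : ∀ z w : E, modulus (z + w) ≤ modulus z + modulus w
  modulus_smul : ∀ (c : ℂ) (z : E), modulus (c • z) = (‖c‖ : ℂ) • modulus z
  /-- On real elements the modulus is the lattice modulus, i.e. the supremum of `x` and `-x`. -/
  modulus_isLUB : ∀ x ∈ real, IsLUB {x, -x} (modulus x)
  norm_modulus : ∀ z : E, ‖modulus z‖ = ‖z‖
  /-- The norm is a lattice norm. -/
  norm_mono : ∀ x y : E, modulus x ≤ modulus y → ‖x‖ ≤ ‖y‖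

/-- The real part `E_ℝ` of a complex Banach lattice. -/
def latticeRealPart (E : Type*) [NormedAddCommGroup E] [NormedSpace ℂ E] [PartialOrder E]
    [ComplexBanachLattice E] : Set E :=
  ComplexBanachLattice.real

/-- A bounded linear operator on a complex Banach lattice is positive if it maps the
positive cone into itself. -/
def IsPositiveOp {E : Type*} [NormedAddCommGroup E] [NormedSpace ℂ E] [PartialOrder E]
    [ComplexBanachLattice E] (T : E →L[ℂ] E) : Prop :=
  ∀ x : E, 0 ≤ x → 0 ≤ T x

section BanachLattice

variable {X : Type*} [NormedAddCommGroup X] [Lattice X] [IsOrderedAddMonoid X] [HasSolidNorm X]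
  [NormedSpace ℝ X] [IsOrderedModule ℝ X]

omit [NormedSpace ℝ X] [IsOrderedModule ℝ X] in
theorem norm_le_norm_of_nonneg_of_le {x y : X} (hx : 0 ≤ x) (h : x ≤ y) : ‖x‖ ≤ ‖y‖ := by
  refine norm_le_norm_of_abs_le_abs ?_
  rwa [abs_of_nonneg hx, abs_of_nonneg (hx.trans h)]

omit [NormedSpace ℝ X] [IsOrderedModule ℝ X] in
theorem norm_le_norm_of_abs_le {x y : X} (h : |x| ≤ y) : ‖x‖ ≤ ‖y‖ := by
  rw [← norm_abs_eq_norm x]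
  exact norm_le_norm_of_nonneg_of_le (abs_nonneg x) h

/-- An order-Lipschitz image of a compact set in a Banach lattice has a supremum. -/
theorem exists_isLUB_image_of_isCompact [CompleteSpace X] {α : Type*} [PseudoMetricSpace α]
    {K : Set α} (hK : IsCompact K) (hne : K.Nonempty) (f : α → X) {e : X} (he : 0 ≤ e)
    (hf : ∀ s ∈ K, ∀ t ∈ K, f s - f t ≤ dist s t • e) : ∃ m, IsLUB (f '' K) m := by
  have key : ∀ k : ℕ, ∃ M : X, M ∈ lowerBounds (upperBounds (f '' K)) ∧
      ∀ s ∈ K, f s ≤ M + (1 / ((k : ℝ) + 1)) • e := by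
    intro k
    obtain ⟨t, htK, htf, hcov⟩ := finite_cover_balls_of_compact hK
      (Nat.one_div_pos_of_nat (α := ℝ) (n := k))
    obtain ⟨s₀, hs₀⟩ := hne
    have htne : htf.toFinset.Nonempty := by
      obtain ⟨x, hx, -⟩ := Set.mem_iUnion₂.1 (hcov hs₀)
      exact ⟨x, by simpa using hx⟩
    refine ⟨htf.toFinset.sup' htne f, fun b hb => ?_, fun s hs => ?_⟩
    · refine Finset.sup'_le _ _ fun c hc => hb ⟨c, htK (by simpa using hc), rfl⟩
    · obtain ⟨x, hx, hsx⟩ := Set.mem_iUnion₂.1 (hcov hs)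
      have h1 : f x ≤ htf.toFinset.sup' htne f := Finset.le_sup' f (by simpa using hx)
      have h2 := hf s hs x (htK hx)
      have h3 : dist s x • e ≤ (1 / ((k : ℝ) + 1)) • e :=
        smul_le_smul_of_nonneg_right (le_of_lt hsx) he
      rw [← sub_add_cancel (f s) (f x), add_comm]
      exact add_le_add h1 (h2.trans h3)
  choose M hM1 hM2 using key
  have hub : ∀ k, M k + (1 / ((k : ℝ) + 1)) • e ∈ upperBounds (f '' K) := by
    rintro k _ ⟨s, hs, rfl⟩
    exact hM2 k s hs
  have hcau : CauchySeq M := by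
    refine cauchySeq_of_le_tendsto_0 (fun N : ℕ => (1 / ((N : ℝ) + 1)) * ‖e‖) ?_ ?_
    · have aux : ∀ n m N : ℕ, N ≤ m → M n - M m ≤ (1 / ((N : ℝ) + 1)) • e := by
        intro n m N hm
        rw [sub_le_iff_le_add']
        refine (hM1 n (hub m)).trans (add_le_add le_rfl ?_)
        exact smul_le_smul_of_nonneg_right (Nat.one_div_le_one_div hm) he
      intro n m N hn hm
      rw [dist_eq_norm]
      have h : |M n - M m| ≤ (1 / ((N : ℝ) + 1)) • e :=
        abs_le'.2 ⟨aux n m N hm, by rw [neg_sub]; exact aux m n N hn⟩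
      refine (norm_le_norm_of_abs_le h).trans ?_
      rw [norm_smul, Real.norm_of_nonneg Nat.one_div_pos_of_nat.le]
    · simpa using (tendsto_one_div_add_atTop_nhds_zero_nat (𝕜 := ℝ)).mul_const ‖e‖
  obtain ⟨m, hm⟩ := cauchySeq_tendsto_of_complete hcau
  refine ⟨m, ?_, fun b hb => le_of_tendsto' hm fun k => hM1 k hb⟩
  rintro _ ⟨s, hs, rfl⟩
  have h : Tendsto (fun k : ℕ => M k + (1 / ((k : ℝ) + 1)) • e) atTop (𝓝 (m + (0 : ℝ) • e)) :=
    hm.add ((tendsto_one_div_add_atTop_nhds_zero_nat (𝕜 := ℝ)).smul_const e)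
  rw [zero_smul, add_zero] at h
  exact ge_of_tendsto' h fun k => hM2 k s hs

omit [HasSolidNorm X] [NormedSpace ℝ X] [IsOrderedModule ℝ X] in
theorem inf_add_le_inf_add_inf {y u v : X} (hy : 0 ≤ y) (hu : 0 ≤ u) (hv : 0 ≤ v) :
    y ⊓ (u + v) ≤ y ⊓ u + y ⊓ v := by
  rw [add_inf, inf_add, inf_add]
  refine le_inf (le_inf ?_ ?_) (le_inf ?_ ?_)
  · exact inf_le_left.trans (le_add_of_nonneg_right hy)
  · exact inf_le_left.trans (le_add_of_nonneg_left hu)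
  · exact inf_le_left.trans (le_add_of_nonneg_right hv)
  · exact inf_le_right

omit [HasSolidNorm X] in
theorem inf_smul_eq_zero {y u : X} (hy : 0 ≤ y) (hu : 0 ≤ u) (h : y ⊓ u = 0) {a : ℝ}
    (ha : 0 ≤ a) : y ⊓ a • u = 0 := by
  refine le_antisymm ?_ (le_inf hy (smul_nonneg ha hu))
  have hk : 0 < 1 + a := by positivity
  have h1 : y ⊓ a • u ≤ (1 + a) • y := inf_le_left.trans <| by
    rw [add_smul, one_smul]; exact le_add_of_nonneg_right (smul_nonneg ha hy)
  have h2 : y ⊓ a • u ≤ (1 + a) • u := inf_le_right.trans <| by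
    rw [add_smul, one_smul]; exact le_add_of_nonneg_left hu
  have h3 : (1 + a)⁻¹ • (y ⊓ a • u) ≤ y ⊓ u :=
    le_inf ((inv_smul_le_iff_of_pos hk).2 h1) ((inv_smul_le_iff_of_pos hk).2 h2)
  rw [h, inv_smul_le_iff_of_pos hk, smul_zero] at h3
  exact h3

/-- If `y` is disjoint from every value of `f` then it is disjoint from the average of `f`. -/
theorem inf_integral_eq_zero [CompleteSpace X] {α : Type*} [MeasurableSpace α]
    {μ : MeasureTheory.Measure α} [MeasureTheory.IsProbabilityMeasure μ] {f : α → X}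
    (hf : MeasureTheory.Integrable f μ) (hf0 : ∀ a, 0 ≤ f a) {y : X} (hy : 0 ≤ y)
    (h : ∀ a, y ⊓ f a = 0) : y ⊓ ∫ a, f a ∂μ = 0 := by
  have hconv : Convex ℝ {v : X | 0 ≤ v ∧ y ⊓ v = 0} := by
    rintro u ⟨hu, hyu⟩ v ⟨hv, hyv⟩ a b ha hb -
    have hau := smul_nonneg ha hu
    have hbv := smul_nonneg hb hv
    refine ⟨add_nonneg hau hbv, le_antisymm ?_ (le_inf hy (add_nonneg hau hbv))⟩
    have := inf_add_le_inf_add_inf hy hau hbv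
    rwa [inf_smul_eq_zero hy hu hyu ha, inf_smul_eq_zero hy hv hyv hb, add_zero] at this
  have hclosed : IsClosed {v : X | 0 ≤ v ∧ y ⊓ v = 0} :=
    isClosed_nonneg.inter (isClosed_eq (continuous_const.inf continuous_id) continuous_const)
  exact (hconv.integral_mem hclosed (.of_forall fun a => ⟨hf0 a, h a⟩) hf).2

end BanachLattice

/-- A presentation of the complex Banach space `E` as the complexification of the real Banach
space `X`, with embedding `ι` and real part `re`. -/
structure Complexification (X E : Type*) [NormedAddCommGroup X] [NormedSpace ℝ X]
    [NormedAddCommGroup E] [NormedSpace ℂ E] where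
  /-- The embedding of the real part. -/
  ι : X →L[ℝ] E
  /-- The real part map. -/
  re : E →L[ℝ] X
  re_ι : ∀ x, re (ι x) = x
  re_I_smul_ι : ∀ x, re (Complex.I • ι x) = 0
  ι_re_add : ∀ z, ι (re z) - Complex.I • ι (re (Complex.I • z)) = z

namespace Complexification

section Linear

variable {X E : Type*} [NormedAddCommGroup X] [NormedSpace ℝ X]
  [NormedAddCommGroup E] [NormedSpace ℂ E] (J : Complexification X E)

theorem complex_smul_eq (d : ℂ) (z : E) : d • z = d.re • z + d.im • (Complex.I • z) := by
  conv_lhs => rw [← Complex.re_add_im d]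
  rw [add_smul, mul_smul, Complex.coe_smul, Complex.coe_smul]

theorem re_smul (d : ℂ) (z : E) :
    J.re (d • z) = d.re • J.re z + d.im • J.re (Complex.I • z) := by
  rw [complex_smul_eq d z, map_add, map_smul, map_smul]

theorem re_smul_ι (d : ℂ) (x : X) : J.re (d • J.ι x) = d.re • x := by
  rw [re_smul, re_ι, re_I_smul_ι, smul_zero, add_zero]

end Linear

variable {X E : Type*} [NormedAddCommGroup X] [Lattice X] [IsOrderedAddMonoid X] [HasSolidNorm X]
  [NormedSpace ℝ X] [IsOrderedModule ℝ X] [CompleteSpace X]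
  [NormedAddCommGroup E] [NormedSpace ℂ E] (J : Complexification X E)

omit [IsOrderedAddMonoid X] [HasSolidNorm X] [CompleteSpace X] in
theorem smul_le_abs_smul_abs (a : ℝ) (x : X) : a • x ≤ |a| • |x| := by
  rcases le_total 0 a with h | h
  · rw [abs_of_nonneg h]
    exact smul_le_smul_of_nonneg_left (le_abs_self x) h
  · rw [abs_of_nonpos h, ← neg_smul_neg]
    exact smul_le_smul_of_nonneg_left (neg_le_abs x) (neg_nonneg.2 h)

omit [HasSolidNorm X] [CompleteSpace X] in
theorem re_smul_le_norm_smul (d : ℂ) (z : E) :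
    J.re (d • z) ≤ ‖d‖ • (|J.re z| + |J.re (Complex.I • z)|) := by
  rw [re_smul, smul_add]
  refine add_le_add ((smul_le_abs_smul_abs _ _).trans ?_) ((smul_le_abs_smul_abs _ _).trans ?_)
  · exact smul_le_smul_of_nonneg_right (Complex.abs_re_le_norm d) (_root_.abs_nonneg _)
  · exact smul_le_smul_of_nonneg_right (Complex.abs_im_le_norm d) (_root_.abs_nonneg _)

theorem exists_isLUB_re_smul (z : E) :
    ∃ m, IsLUB ((fun d : ℂ => J.re (d • z)) '' Metric.sphere (0 : ℂ) 1) m := by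
  refine exists_isLUB_image_of_isCompact (isCompact_sphere _ _) ⟨1, by simp⟩ _
    (e := |J.re z| + |J.re (Complex.I • z)|) (by positivity) fun s _ t _ => ?_
  rw [← map_sub, ← sub_smul, dist_eq_norm]
  exact J.re_smul_le_norm_smul _ _

/-- The modulus `sup_θ Re (e^{iθ} z)` of `z`. -/
def abs (z : E) : X := (J.exists_isLUB_re_smul z).choose

theorem re_smul_le_abs {d : ℂ} (hd : ‖d‖ = 1) (z : E) : J.re (d • z) ≤ J.abs z :=
  (J.exists_isLUB_re_smul z).choose_spec.1 ⟨d, by simpa using hd, rfl⟩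

theorem abs_le {z : E} {b : X} (h : ∀ d : ℂ, ‖d‖ = 1 → J.re (d • z) ≤ b) : J.abs z ≤ b := by
  refine (J.exists_isLUB_re_smul z).choose_spec.2 ?_
  rintro _ ⟨d, hd, rfl⟩
  exact h d (by simpa using hd)

theorem abs_re_le_abs (z : E) : |J.re z| ≤ J.abs z := by
  refine abs_le'.2 ⟨?_, ?_⟩
  · simpa using J.re_smul_le_abs (d := 1) (by simp) z
  · simpa using J.re_smul_le_abs (d := -1) (by simp) z

theorem abs_nonneg (z : E) : 0 ≤ J.abs z := (_root_.abs_nonneg _).trans (J.abs_re_le_abs z)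

theorem re_smul_le (d : ℂ) (z : E) : J.re (d • z) ≤ ‖d‖ • J.abs z := by
  rcases eq_or_ne d 0 with rfl | hd
  · simp
  have hd' : (0 : ℝ) < ‖d‖ := norm_pos_iff.2 hd
  have h := J.re_smul_le_abs (d := (‖d‖⁻¹ : ℝ) • d) (by
    rw [norm_smul, norm_inv, norm_norm, inv_mul_cancel₀ hd'.ne']) z
  rwa [smul_assoc, map_smul, inv_smul_le_iff_of_pos hd'] at h

theorem abs_add_le (z w : E) : J.abs (z + w) ≤ J.abs z + J.abs w :=
  J.abs_le fun d hd => by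
    rw [smul_add, map_add]
    exact add_le_add (J.re_smul_le_abs hd z) (J.re_smul_le_abs hd w)

theorem abs_smul_le (c : ℂ) (z : E) : J.abs (c • z) ≤ ‖c‖ • J.abs z :=
  J.abs_le fun d hd => by
    rw [smul_smul]
    simpa [hd] using J.re_smul_le (d * c) z

theorem abs_smul_of_norm_eq_one {c : ℂ} (hc : ‖c‖ = 1) (z : E) : J.abs (c • z) = J.abs z := by
  have hc0 : c ≠ 0 := fun h => by simp [h] at hc
  refine le_antisymm (by simpa [hc] using J.abs_smul_le c z) ?_
  simpa [hc, hc0] using J.abs_smul_le c⁻¹ (c • z)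

@[simp] theorem abs_zero : J.abs 0 = 0 :=
  le_antisymm (J.abs_le fun d _ => by simp) (J.abs_nonneg 0)

theorem abs_sub_rev (z w : E) : J.abs (z - w) = J.abs (w - z) := by
  rw [← neg_sub w z, ← neg_one_smul ℂ, J.abs_smul_of_norm_eq_one (by simp)]

theorem abs_abs_sub_abs_le (z w : E) : |J.abs z - J.abs w| ≤ J.abs (z - w) := by
  have aux : ∀ z w : E, J.abs z - J.abs w ≤ J.abs (z - w) := fun z w => by
    rw [sub_le_iff_le_add]
    simpa using J.abs_add_le (z - w) w
  refine abs_le'.2 ⟨aux z w, ?_⟩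
  rw [neg_sub, J.abs_sub_rev]
  exact aux w z

theorem abs_sum_le {κ : Type*} (s : Finset κ) (f : κ → E) :
    J.abs (∑ i ∈ s, f i) ≤ ∑ i ∈ s, J.abs (f i) :=
  Finset.le_sum_of_subadditive _ J.abs_zero.le J.abs_add_le s f

theorem abs_le_abs_re_add (z : E) : J.abs z ≤ |J.re z| + |J.re (Complex.I • z)| :=
  J.abs_le fun d hd => by simpa [hd] using J.re_smul_le_norm_smul d z

theorem norm_abs_le (z : E) : ‖J.abs z‖ ≤ 2 * ‖J.re‖ * ‖z‖ := by
  refine (norm_le_norm_of_nonneg_of_le (J.abs_nonneg z) (J.abs_le_abs_re_add z)).trans ?_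
  refine (norm_add_le _ _).trans ?_
  rw [norm_abs_eq_norm, norm_abs_eq_norm]
  have h1 := J.re.le_opNorm z
  have h2 := J.re.le_opNorm (Complex.I • z)
  rw [norm_smul, Complex.norm_I, one_mul] at h2
  linarith

theorem norm_le (z : E) : ‖z‖ ≤ 2 * ‖J.ι‖ * ‖J.abs z‖ := by
  have h1 : ‖J.re z‖ ≤ ‖J.abs z‖ := norm_le_norm_of_abs_le (J.abs_re_le_abs z)
  have h2 : ‖J.re (Complex.I • z)‖ ≤ ‖J.abs z‖ := by
    have := norm_le_norm_of_abs_le (J.abs_re_le_abs (Complex.I • z))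
    rwa [J.abs_smul_of_norm_eq_one (by simp)] at this
  have h3 := J.ι.le_opNorm (J.re z)
  have h4 := J.ι.le_opNorm (J.re (Complex.I • z))
  have h5 := mul_le_mul_of_nonneg_left h1 (norm_nonneg J.ι)
  have h6 := mul_le_mul_of_nonneg_left h2 (norm_nonneg J.ι)
  calc ‖z‖ = ‖J.ι (J.re z) - Complex.I • J.ι (J.re (Complex.I • z))‖ := by rw [J.ι_re_add]
    _ ≤ ‖J.ι (J.re z)‖ + ‖J.ι (J.re (Complex.I • z))‖ := by
      refine (norm_sub_le _ _).trans ?_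
      rw [norm_smul, Complex.norm_I, one_mul]
    _ ≤ _ := by linarith

theorem continuous_abs : Continuous J.abs := by
  refine LipschitzWith.continuous (K := (2 * ‖J.re‖).toNNReal) (.of_dist_le_mul fun z w => ?_)
  rw [dist_eq_norm, dist_eq_norm, Real.coe_toNNReal _ (by positivity)]
  exact (norm_le_norm_of_abs_le (J.abs_abs_sub_abs_le z w)).trans (J.norm_abs_le _)

/-- A positive operator on `X` dominates its complexification. -/
theorem abs_map_le (T : E →L[ℂ] E) {S : X →L[ℝ] X} (hS : ∀ x, 0 ≤ x → 0 ≤ S x)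
    (hTS : ∀ z, J.re (T z) = S (J.re z)) (z : E) : J.abs (T z) ≤ S (J.abs z) := by
  refine J.abs_le fun d hd => ?_
  rw [← map_smul, hTS, ← sub_nonneg, ← map_sub]
  exact hS _ (sub_nonneg.2 (J.re_smul_le_abs hd z))

end Complexification

namespace Complexification

open MeasureTheory AddCircle

variable {X E : Type*} [NormedAddCommGroup X] [Lattice X] [IsOrderedAddMonoid X] [HasSolidNorm X]
  [NormedSpace ℝ X] [IsOrderedModule ℝ X] [CompleteSpace X]
  [NormedAddCommGroup E] [NormedSpace ℂ E] (J : Complexification X E)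

/-- The `n`-th power of the point of the unit circle with parameter `t`. -/
def phase (n : ℤ) (t : UnitAddCircle) : ℂ := ((toCircle t ^ n : Circle) : ℂ)

theorem norm_phase (n : ℤ) (t : UnitAddCircle) : ‖phase n t‖ = 1 := Circle.norm_coe _

theorem phase_eq_zpow (n : ℤ) (t : UnitAddCircle) : phase n t = (toCircle t : ℂ) ^ n := by
  simp [phase]

theorem phase_add (n : ℤ) (s t : UnitAddCircle) : phase n (s + t) = phase n s * phase n t := by
  simp only [phase_eq_zpow, toCircle_add, Circle.coe_mul, mul_zpow]

theorem phase_mul_phase_neg (n : ℤ) (t : UnitAddCircle) : phase n t * phase (-n) t = 1 := by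
  rw [phase_eq_zpow, phase_eq_zpow, zpow_neg, mul_inv_cancel₀]
  exact zpow_ne_zero _ (Circle.coe_ne_zero _)

/-- The part of `z` whose phase is close to `-t`. -/
def bump (κ : ℝ) (z : E) (t : UnitAddCircle) : X :=
  J.re ((toCircle t : ℂ) • z) ⊔ κ • J.abs z - κ • J.abs z

/-- The sum of the two sublinear maps whose difference is `bump`. -/
def hull (κ : ℝ) (z : E) (t : UnitAddCircle) : X :=
  J.re ((toCircle t : ℂ) • z) ⊔ κ • J.abs z + κ • J.abs z

/-- A multiple of `|z| (z / |z|) ^ n`, up to a lattice-theoretic smoothing. -/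
def power (κ : ℝ) (n : ℤ) (z : E) : E :=
  ∫ t, phase (-n) t • J.ι (J.bump κ z t) ∂haarAddCircle

/-- The mean of `bump`. -/
def bumpMean (κ : ℝ) (z : E) : X := ∫ t, J.bump κ z t ∂haarAddCircle

/-- The mean of `hull`. -/
def hullMean (κ : ℝ) (z : E) : X := ∫ t, J.hull κ z t ∂haarAddCircle

section Basic

variable {κ : ℝ}

theorem bump_nonneg (z : E) (t : UnitAddCircle) : 0 ≤ J.bump κ z t :=
  sub_nonneg.2 le_sup_right

omit [Lattice X] [IsOrderedAddMonoid X] [HasSolidNorm X] [IsOrderedModule ℝ X]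
  [CompleteSpace X] in
theorem continuous_re_toCircle_smul (z : E) :
    Continuous fun t : UnitAddCircle => J.re ((toCircle t : ℂ) • z) := by
  have : Continuous fun t : UnitAddCircle => (toCircle t : ℂ) :=
    continuous_subtype_val.comp continuous_toCircle
  fun_prop

theorem continuous_bump (z : E) : Continuous (J.bump κ z) :=
  ((J.continuous_re_toCircle_smul z).sup continuous_const).sub continuous_const

theorem continuous_hull (z : E) : Continuous (J.hull κ z) :=
  ((J.continuous_re_toCircle_smul z).sup continuous_const).add continuous_const

theorem _root_.Continuous.integrable_haarAddCircle {F : Type*} [NormedAddCommGroup F]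
    {f : UnitAddCircle → F} (hf : Continuous f) : Integrable f haarAddCircle :=
  hf.integrable_of_hasCompactSupport (HasCompactSupport.of_compactSpace f)

theorem continuous_phase (n : ℤ) :
    Continuous (phase n) :=
  continuous_subtype_val.comp (continuous_toCircle.zpow n)

theorem abs_integral_le [CompleteSpace E] {w : UnitAddCircle → ℂ} {F G : UnitAddCircle → X}
    (hw : Continuous w) (hF : Continuous F) (hG : Continuous G)
    (h : ∀ t, ‖w t‖ • |F t| ≤ G t) :
    J.abs (∫ t, w t • J.ι (F t) ∂haarAddCircle) ≤ ∫ t, G t ∂haarAddCircle := by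
  refine J.abs_le fun d hd => ?_
  have hi : Continuous fun t => d • w t • J.ι (F t) :=
    (hw.smul (J.ι.continuous.comp hF)).const_smul d
  rw [← integral_smul, ← J.re.integral_comp_comm hi.integrable_haarAddCircle]
  refine integral_mono (J.re.continuous.comp hi).integrable_haarAddCircle
    hG.integrable_haarAddCircle fun t => ?_
  simp only [smul_smul, re_smul_ι]
  refine (smul_le_abs_smul_abs _ _).trans (le_trans ?_ (h t))
  refine smul_le_smul_of_nonneg_right ?_ (_root_.abs_nonneg _)
  exact (Complex.abs_re_le_norm _).trans (by rw [norm_mul, hd, one_mul])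

theorem bump_toCircle_smul (s t : UnitAddCircle) (z : E) :
    J.bump κ ((toCircle s : ℂ) • z) t = J.bump κ z (t + s) := by
  rw [bump, bump, J.abs_smul_of_norm_eq_one (Circle.norm_coe _), toCircle_add, smul_smul,
    Circle.coe_mul]

theorem hull_toCircle_smul (s t : UnitAddCircle) (z : E) :
    J.hull κ ((toCircle s : ℂ) • z) t = J.hull κ z (t + s) := by
  rw [hull, hull, J.abs_smul_of_norm_eq_one (Circle.norm_coe _), toCircle_add, smul_smul,
    Circle.coe_mul]

theorem hullMean_toCircle_smul (s : UnitAddCircle) (z : E) :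
    J.hullMean κ ((toCircle s : ℂ) • z) = J.hullMean κ z := by
  simp only [hullMean, hull_toCircle_smul]
  exact integral_add_right_eq_self (J.hull κ z) s

theorem power_toCircle_smul (n : ℤ) (s : UnitAddCircle) (z : E) :
    J.power κ n ((toCircle s : ℂ) • z) = phase n s • J.power κ n z := by
  simp only [power, bump_toCircle_smul]
  rw [← integral_add_right_eq_self (fun t => phase (-n) t • J.ι (J.bump κ z t)) s,
    ← integral_smul]
  refine integral_congr_ae (.of_forall fun t => ?_)
  simp only [smul_smul, phase_add]
  rw [mul_left_comm, phase_mul_phase_neg, mul_one]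

theorem abs_bump_sub_le (hκ : 0 ≤ κ) (hκ1 : κ ≤ 1) (z w : E) (t : UnitAddCircle) :
    |J.bump κ z t - J.bump κ w t| ≤ (4 : ℝ) • J.abs (z - w) ∧
      |J.hull κ z t - J.hull κ w t| ≤ (4 : ℝ) • J.abs (z - w) := by
  set m := J.abs (z - w)
  have hm : 0 ≤ m := J.abs_nonneg _
  have h1 : |J.re ((toCircle t : ℂ) • z) - J.re ((toCircle t : ℂ) • w)| ≤ m := by
    rw [← map_sub, ← smul_sub]
    exact (J.abs_re_le_abs _).trans (J.abs_smul_of_norm_eq_one (Circle.norm_coe _) _).le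
  have h2 : |κ • J.abs z - κ • J.abs w| ≤ m := by
    rw [← smul_sub]
    have h := J.abs_abs_sub_abs_le z w
    have aux : ∀ x : X, x ≤ m → κ • x ≤ m := fun x hx =>
      (smul_le_smul_of_nonneg_left hx hκ).trans
        ((smul_le_smul_of_nonneg_right hκ1 hm).trans (one_smul ℝ m).le)
    refine abs_le'.2 ⟨aux _ ((le_abs_self _).trans h), ?_⟩
    rw [← smul_neg]
    exact aux _ ((neg_le_abs _).trans h)
  set a := J.re ((toCircle t : ℂ) • z)
  set a' := J.re ((toCircle t : ℂ) • w)
  set b := κ • J.abs z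
  set b' := κ • J.abs w
  have h3 : |a ⊔ b - a' ⊔ b'| ≤ m + m := by
    have e : a ⊔ b - a' ⊔ b' = (a ⊔ b - a' ⊔ b) + (b ⊔ a' - b' ⊔ a') := by
      rw [sup_comm b a', sup_comm b' a']; abel
    rw [e]
    exact (_root_.abs_add_le _ _).trans (add_le_add ((abs_sup_sub_sup_le_abs _ _ _).trans h1)
      ((abs_sup_sub_sup_le_abs _ _ _).trans h2))
  have h4 : m + m + m ≤ (4 : ℝ) • m := by
    have : (4 : ℝ) • m = m + m + m + m := by module
    rw [this]
    exact le_add_of_nonneg_right hm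
  constructor
  · have e : J.bump κ z t - J.bump κ w t = (a ⊔ b - a' ⊔ b') - (b - b') := by
      simp only [bump, a, b, a', b']; abel
    rw [e, sub_eq_add_neg]
    refine (_root_.abs_add_le _ _).trans ((add_le_add h3 ?_).trans h4)
    rwa [abs_neg]
  · have e : J.hull κ z t - J.hull κ w t = (a ⊔ b - a' ⊔ b') + (b - b') := by
      simp only [hull, a, b, a', b']; abel
    rw [e]
    exact (_root_.abs_add_le _ _).trans ((add_le_add h3 h2).trans h4)

omit [Lattice X] [IsOrderedAddMonoid X] [HasSolidNorm X] [IsOrderedModule ℝ X] in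
theorem integral_haarAddCircle_const (x : X) :
    ∫ _t : UnitAddCircle, x ∂haarAddCircle = x := by simp

theorem continuous_power_integrand (n : ℤ) (z : E) :
    Continuous fun t : UnitAddCircle =>
      phase n t • J.ι (J.bump κ z t) :=
  (continuous_phase n).smul (J.ι.continuous.comp (J.continuous_bump z))

theorem abs_power_sub_le [CompleteSpace E] (hκ : 0 ≤ κ) (hκ1 : κ ≤ 1) (n : ℤ) (z w : E) :
    J.abs (J.power κ n z - J.power κ n w) ≤ (4 : ℝ) • J.abs (z - w) := by
  rw [power, power, ← integral_sub (J.continuous_power_integrand _ _).integrable_haarAddCircle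
    (J.continuous_power_integrand _ _).integrable_haarAddCircle]
  simp only [← smul_sub, ← map_sub]
  refine (J.abs_integral_le (continuous_phase _)
    ((J.continuous_bump z).sub (J.continuous_bump w))
    (continuous_const (y := (4 : ℝ) • J.abs (z - w))) fun t => ?_).trans
    (integral_haarAddCircle_const _).le
  rw [norm_phase, one_smul]
  exact (J.abs_bump_sub_le hκ hκ1 z w t).1

theorem hullMean_le_add (hκ : 0 ≤ κ) (hκ1 : κ ≤ 1) (z w : E) :
    J.hullMean κ z ≤ J.hullMean κ w + (4 : ℝ) • J.abs (z - w) := by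
  rw [hullMean, hullMean, ← integral_haarAddCircle_const ((4 : ℝ) • J.abs (z - w)),
    ← integral_add (J.continuous_hull _).integrable_haarAddCircle
      continuous_const.integrable_haarAddCircle]
  refine integral_mono (J.continuous_hull _).integrable_haarAddCircle
    ((J.continuous_hull _).add continuous_const).integrable_haarAddCircle fun t => ?_
  rw [← sub_le_iff_le_add']
  exact (le_abs_self _).trans (J.abs_bump_sub_le hκ hκ1 z w t).2

theorem hullMean_le (hκ1 : κ ≤ 1) (z : E) : J.hullMean κ z ≤ (2 : ℝ) • J.abs z := by
  rw [hullMean, ← integral_haarAddCircle_const ((2 : ℝ) • J.abs z)]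
  refine integral_mono (J.continuous_hull _).integrable_haarAddCircle
    continuous_const.integrable_haarAddCircle fun t => ?_
  have h : κ • J.abs z ≤ J.abs z :=
    (smul_le_smul_of_nonneg_right hκ1 (J.abs_nonneg z)).trans (one_smul _ _).le
  rw [two_smul]
  exact add_le_add (sup_le (J.re_smul_le_abs (Circle.norm_coe _) z) h) h

theorem smul_abs_le_hullMean (hκ : 0 ≤ κ) (z : E) : κ • J.abs z ≤ J.hullMean κ z := by
  rw [hullMean, ← integral_haarAddCircle_const (κ • J.abs z)]
  refine integral_mono continuous_const.integrable_haarAddCircle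
    (J.continuous_hull _).integrable_haarAddCircle fun t => ?_
  exact le_add_of_le_of_nonneg le_sup_right (smul_nonneg hκ (J.abs_nonneg z))

theorem abs_power_le [CompleteSpace E] (n : ℤ) (z : E) :
    J.abs (J.power κ n z) ≤ J.bumpMean κ z := by
  refine J.abs_integral_le (continuous_phase _) (J.continuous_bump z)
    (J.continuous_bump z) fun t => ?_
  rw [norm_phase, one_smul, abs_of_nonneg (J.bump_nonneg z t)]

theorem bumpMean_le_hullMean (hκ : 0 ≤ κ) (z : E) : J.bumpMean κ z ≤ J.hullMean κ z := by
  refine integral_mono (J.continuous_bump _).integrable_haarAddCircle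
    (J.continuous_hull _).integrable_haarAddCircle fun t => ?_
  have h := smul_nonneg hκ (J.abs_nonneg z)
  exact (sub_le_self _ h).trans (le_add_of_nonneg_right h)

end Basic

/-- Jensen's inequality: the defect of `power` is controlled by the defect of `hullMean`. -/
theorem abs_map_power_sub_le [CompleteSpace E] {κ : ℝ} (hκ : 0 ≤ κ) (n : ℤ)
    (T : E →L[ℂ] E) {S : X →L[ℝ] X} (hS : ∀ x, 0 ≤ x → 0 ≤ S x)
    (hTS : ∀ z, J.re (T z) = S (J.re z)) (hTι : ∀ x, T (J.ι x) = J.ι (S x)) (z : E) :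
    J.abs (T (J.power κ n z) - J.power κ n (T z)) ≤
      S (J.hullMean κ z) - J.hullMean κ (T z) := by
  have hmono : ∀ x y : X, x ≤ y → S x ≤ S y := fun x y h => by
    rw [← sub_nonneg, ← map_sub]; exact hS _ (sub_nonneg.2 h)
  have hcB := (J.continuous_bump (κ := κ) z)
  have hcH := (J.continuous_hull (κ := κ) z)
  rw [power, power, hullMean, hullMean,
    ← T.integral_comp_comm (J.continuous_power_integrand _ _).integrable_haarAddCircle,
    ← S.integral_comp_comm hcH.integrable_haarAddCircle]
  simp only [map_smul, hTι]
  have hcT : Continuous fun t => phase (-n) t • J.ι (S (J.bump κ z t)) :=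
    (continuous_phase _).smul (J.ι.continuous.comp (S.continuous.comp hcB))
  have hcS : Continuous fun t => S (J.hull κ z t) := S.continuous.comp hcH
  rw [← integral_sub hcT.integrable_haarAddCircle
      (J.continuous_power_integrand _ _).integrable_haarAddCircle,
    ← integral_sub hcS.integrable_haarAddCircle
      (J.continuous_hull _).integrable_haarAddCircle]
  simp only [← smul_sub, ← map_sub]
  refine J.abs_integral_le (continuous_phase _)
    ((S.continuous.comp hcB).sub (J.continuous_bump _))
    ((S.continuous.comp hcH).sub (J.continuous_hull _)) fun t => ?_
  rw [norm_phase, one_smul]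
  have h1 : J.re ((toCircle t : ℂ) • T z) ⊔ κ • J.abs (T z) ≤
      S (J.re ((toCircle t : ℂ) • z) ⊔ κ • J.abs z) := by
    refine sup_le ?_ ?_
    · rw [← map_smul, hTS]
      exact hmono _ _ le_sup_left
    · refine le_trans ?_ (hmono _ _ le_sup_right)
      rw [map_smul]
      exact smul_le_smul_of_nonneg_left (J.abs_map_le T hS hTS z) hκ
  have h2 : κ • J.abs (T z) ≤ S (κ • J.abs z) := by
    rw [map_smul]
    exact smul_le_smul_of_nonneg_left (J.abs_map_le T hS hTS z) hκ
  simp only [bump, hull, map_sub, map_add]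
  set a := S (J.re ((toCircle t : ℂ) • z) ⊔ κ • J.abs z)
  set a' := J.re ((toCircle t : ℂ) • T z) ⊔ κ • J.abs (T z)
  set b := S (κ • J.abs z)
  set b' := κ • J.abs (T z)
  have e1 : a - b - (a' - b') = (a - a') - (b - b') := by abel
  have e2 : a + b - (a' + b') = (a - a') + (b - b') := by abel
  rw [e1, e2]
  refine abs_le'.2 ⟨?_, ?_⟩
  · exact (sub_le_self _ (sub_nonneg.2 h2)).trans (le_add_of_nonneg_right (sub_nonneg.2 h2))
  · rw [neg_sub]
    exact (sub_le_self _ (sub_nonneg.2 h1)).trans (le_add_of_nonneg_left (sub_nonneg.2 h1))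

end Complexification

namespace Complexification

open MeasureTheory AddCircle

theorem norm_zpow_sub_zpow_le {a b : ℂ} (ha : ‖a‖ = 1) (hb : ‖b‖ = 1) (n : ℤ) :
    ‖a ^ n - b ^ n‖ ≤ |(n : ℝ)| * ‖a - b‖ := by
  have hnat : ∀ {a b : ℂ}, ‖a‖ = 1 → ‖b‖ = 1 → ∀ k : ℕ, ‖a ^ k - b ^ k‖ ≤ k * ‖a - b‖ := by
    intro a b ha hb k
    induction k with
    | zero => simp
    | succ k ih =>
      have e : a ^ (k + 1) - b ^ (k + 1) = a * (a ^ k - b ^ k) + (a - b) * b ^ k := by ring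
      rw [e]
      refine (norm_add_le _ _).trans ?_
      rw [norm_mul, norm_mul, ha, norm_pow, hb]
      push_cast
      rw [one_pow]
      linarith
  have hinv : ‖a⁻¹ - b⁻¹‖ = ‖a - b‖ := by
    rw [inv_sub_inv (by rintro rfl; simp at ha) (by rintro rfl; simp at hb), norm_div, norm_mul,
      ha, hb, norm_sub_rev]
    simp
  rcases Int.eq_nat_or_neg n with ⟨k, rfl | rfl⟩
  · simpa using hnat ha hb k
  · have := hnat (a := a⁻¹) (b := b⁻¹) (by simp [ha]) (by simp [hb]) k
    simpa [hinv] using this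

theorem norm_phase_sub_phase_le (n : ℤ) (s t : UnitAddCircle) :
    ‖phase n s - phase n t‖ ≤ |(n : ℝ)| * ‖(toCircle s : ℂ) - toCircle t‖ := by
  rw [phase_eq_zpow, phase_eq_zpow]
  exact norm_zpow_sub_zpow_le (Circle.norm_coe _) (Circle.norm_coe _) n

variable {X E : Type*} [NormedAddCommGroup X] [Lattice X] [IsOrderedAddMonoid X] [HasSolidNorm X]
  [NormedSpace ℝ X] [IsOrderedModule ℝ X] [CompleteSpace X]
  [NormedAddCommGroup E] [NormedSpace ℂ E] (J : Complexification X E)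

theorem bump_inf_bump_eq_zero {κ : ℝ} (z : E) {s t : UnitAddCircle}
    (h : ‖(toCircle s : ℂ) + toCircle t‖ ≤ 2 * κ) : J.bump κ z s ⊓ J.bump κ z t = 0 := by
  let _ := AddCommGroup.toDistribLattice X
  rw [bump, bump, ← inf_sub, ← sup_inf_right, sub_eq_zero, sup_eq_right]
  set a := J.re ((toCircle s : ℂ) • z)
  set b := J.re ((toCircle t : ℂ) • z)
  have h1 : (2 : ℝ) • (a ⊓ b) ≤ (2 : ℝ) • (κ • J.abs z) := by
    rw [two_smul, smul_smul]
    refine (add_le_add inf_le_left inf_le_right).trans ?_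
    rw [← map_add, ← add_smul]
    exact (J.re_smul_le _ z).trans (smul_le_smul_of_nonneg_right h (J.abs_nonneg z))
  exact le_of_smul_le_smul_of_pos_left h1 two_pos

theorem smul_bumpMean_le_abs_power [CompleteSpace E] {κ η : ℝ} (n : ℤ)
    (hη : |(n : ℝ)| * η ≤ 1 / 2)
    (hκ : ∀ s t : UnitAddCircle, η ≤ ‖(toCircle s : ℂ) - toCircle t‖ →
      ‖(toCircle s : ℂ) + toCircle t‖ ≤ 2 * κ) (z : E) :
    (1 / 2 : ℝ) • J.bumpMean κ z ≤ J.abs (J.power κ n z) := by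
  set b := J.bumpMean κ z with hb
  set p := J.power κ n z with hp
  have hcB := J.continuous_bump (κ := κ) z
  have hb0 : 0 ≤ b := integral_nonneg (J.bump_nonneg z)
  set y := ((1 / 2 : ℝ) • b - J.abs p) ⊔ 0 with hy
  have hy0 : 0 ≤ y := le_sup_right
  have hyb : y ≤ b := by
    refine sup_le ?_ hb0
    refine (sub_le_self _ (J.abs_nonneg p)).trans ?_
    exact (smul_le_smul_of_nonneg_right (by norm_num) hb0).trans (one_smul ℝ b).le
  have key : ∀ s, y ⊓ J.bump κ z s = 0 := by
    intro s
    set W : UnitAddCircle → ℝ := fun t => max (‖phase (-n) t - phase (-n) s‖ - 1 / 2) 0 with hW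
    have hcW : Continuous W :=
      ((((continuous_phase _).sub continuous_const).norm).sub continuous_const).max
        continuous_const
    have hW0 : ∀ t, 0 ≤ W t := fun t => le_max_right _ _
    set D := ∫ t, W t • J.bump κ z t ∂haarAddCircle
    have hD0 : 0 ≤ D := integral_nonneg fun t => smul_nonneg (hW0 t) (J.bump_nonneg z t)
    have hdisj : J.bump κ z s ⊓ D = 0 := by
      refine inf_integral_eq_zero (hcW.smul hcB).integrable_haarAddCircle
        (fun t => smul_nonneg (hW0 t) (J.bump_nonneg z t)) (J.bump_nonneg z s) fun t => ?_
      change J.bump κ z s ⊓ W t • J.bump κ z t = 0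
      rcases le_or_gt ‖phase (-n) t - phase (-n) s‖ (1 / 2) with h | h
      · have : W t = 0 := max_eq_right (by linarith)
        rw [this, zero_smul, inf_eq_right]
        exact J.bump_nonneg z s
      · refine inf_smul_eq_zero (J.bump_nonneg z s) (J.bump_nonneg z t) ?_ (hW0 t)
        refine J.bump_inf_bump_eq_zero z (hκ s t ?_)
        by_contra! hlt
        have h1 := norm_phase_sub_phase_le (-n) t s
        rw [norm_sub_rev (toCircle t : ℂ)] at h1
        push_cast at h1
        rw [abs_neg] at h1
        have h2 := mul_le_mul_of_nonneg_left hlt.le (_root_.abs_nonneg (n : ℝ))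
        linarith
    have h1 : J.abs (p - phase (-n) s • J.ι b) ≤ (1 / 2 : ℝ) • b + D := by
      have hι : J.ι b = ∫ t, J.ι (J.bump κ z t) ∂haarAddCircle :=
        (J.ι.integral_comp_comm hcB.integrable_haarAddCircle).symm
      have hcι : Continuous fun t => phase (-n) s • J.ι (J.bump κ z t) :=
        (J.ι.continuous.comp hcB).const_smul _
      have hcWB : Continuous fun t => W t • J.bump κ z t := hcW.smul hcB
      have hcB' : Continuous fun t => (1 / 2 : ℝ) • J.bump κ z t := hcB.const_smul _
      rw [hι, hp, power, ← integral_smul, ← integral_sub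
        (J.continuous_power_integrand _ _).integrable_haarAddCircle hcι.integrable_haarAddCircle,
        hb, bumpMean, ← integral_smul, ← integral_add hcB'.integrable_haarAddCircle
        hcWB.integrable_haarAddCircle]
      simp only [← sub_smul]
      refine J.abs_integral_le ((continuous_phase _).sub continuous_const) hcB
        (hcB'.add hcWB) fun t => ?_
      rw [abs_of_nonneg (J.bump_nonneg z t), ← add_smul]
      refine smul_le_smul_of_nonneg_right ?_ (J.bump_nonneg z t)
      have := le_max_left (‖phase (-n) t - phase (-n) s‖ - 1 / 2) 0
      simp only [hW]
      linarith
    have h2 : b ≤ J.abs p + ((1 / 2 : ℝ) • b + D) := by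
      calc b = J.re (J.ι b) := (J.re_ι b).symm
        _ ≤ J.abs (J.ι b) := (le_abs_self _).trans (J.abs_re_le_abs _)
        _ = J.abs (phase (-n) s • J.ι b) := (J.abs_smul_of_norm_eq_one (norm_phase _ _) _).symm
        _ = J.abs (p + (phase (-n) s • J.ι b - p)) := by rw [add_sub_cancel]
        _ ≤ J.abs p + J.abs (phase (-n) s • J.ι b - p) := J.abs_add_le _ _
        _ ≤ _ := by rw [J.abs_sub_rev]; exact add_le_add le_rfl h1
    have h3 : y ≤ D := by
      refine sup_le ?_ hD0
      rw [sub_le_iff_le_add, ← add_le_add_iff_left ((1 / 2 : ℝ) • b)]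
      have e : (1 / 2 : ℝ) • b + (1 / 2 : ℝ) • b = b := by module
      rw [e]
      exact h2.trans (le_of_eq (by abel))
    refine le_antisymm ?_ (le_inf hy0 (J.bump_nonneg z s))
    rw [← hdisj, inf_comm]
    exact inf_le_inf_left _ h3
  have h4 : y ⊓ b = 0 :=
    inf_integral_eq_zero hcB.integrable_haarAddCircle (J.bump_nonneg z) hy0 key
  rw [inf_eq_left.2 hyb] at h4
  rw [← sub_nonpos]
  exact le_sup_left.trans h4.le

theorem exists_smul_abs_le_bumpMean {κ : ℝ} (hκ0 : 0 ≤ κ) (hκ1 : κ < 1) :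
    ∃ δ : ℝ, 0 < δ ∧ ∀ z : E, δ • J.abs z ≤ J.bumpMean κ z := by
  set γ := (1 - κ) / 2 with hγ
  have hγ0 : 0 < γ := by simp only [hγ]; linarith
  set χ : UnitAddCircle → ℝ := fun t => max (γ - ‖(toCircle t : ℂ) - 1‖) 0 with hχ
  have hcχ : Continuous χ :=
    (continuous_const.sub (((continuous_subtype_val.comp continuous_toCircle).sub
      continuous_const).norm)).max continuous_const
  have hχ0 : ∀ t, 0 ≤ χ t := fun t => le_max_right _ _
  have hχ1 : ∀ t, χ t ≤ 1 := fun t =>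
    max_le (by have := norm_nonneg ((toCircle t : ℂ) - 1); simp only [hγ]; linarith) zero_le_one
  set I := ∫ t, χ t ∂haarAddCircle with hI
  have hI0 : 0 < I := by
    refine hcχ.integral_pos_of_hasCompactSupport_nonneg_nonzero
      (HasCompactSupport.of_compactSpace χ) hχ0 (x := 0) ?_
    simp [hχ, hγ0.not_ge]
  refine ⟨I * γ, by positivity, fun z => ?_⟩
  have key : ∀ s : UnitAddCircle, I • (J.re ((toCircle s : ℂ) • z) - (κ + γ) • J.abs z) ≤
      J.bumpMean κ z := by
    intro s
    set v := J.re ((toCircle s : ℂ) • z) - (κ + γ) • J.abs z with hv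
    have hcv : Continuous fun t => χ t • v := hcχ.smul continuous_const
    have hcs : Continuous fun t => J.bump κ z (t + s) :=
      (J.continuous_bump z).comp (continuous_id.add continuous_const)
    rw [bumpMean, ← integral_add_right_eq_self (J.bump κ z) s, hI, ← integral_smul_const]
    refine integral_mono hcv.integrable_haarAddCircle hcs.integrable_haarAddCircle fun t => ?_
    have hB := J.bump_nonneg (κ := κ) z (t + s)
    rcases le_or_gt γ ‖(toCircle t : ℂ) - 1‖ with h | h
    · have : χ t = 0 := max_eq_right (by linarith)
      simp only [this, zero_smul]
      exact hB
    · have h1 : J.re ((toCircle s : ℂ) • z) - J.re ((toCircle (t + s) : ℂ) • z) ≤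
          γ • J.abs z := by
        rw [← map_sub, ← sub_smul]
        refine (J.re_smul_le _ _).trans (smul_le_smul_of_nonneg_right ?_ (J.abs_nonneg z))
        have e : (toCircle s : ℂ) - toCircle (t + s) = -(((toCircle t : ℂ) - 1) * toCircle s) := by
          rw [toCircle_add, Circle.coe_mul]; ring
        rw [e, norm_neg, norm_mul, Circle.norm_coe, mul_one]
        exact h.le
      have h2 : v ≤ J.bump κ z (t + s) := by
        refine le_trans ?_ (sub_le_sub_right le_sup_left _)
        rw [← sub_nonneg] at h1 ⊢
        refine h1.trans_eq ?_
        rw [hv, add_smul]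
        abel
      calc χ t • v ≤ χ t • J.bump κ z (t + s) := smul_le_smul_of_nonneg_left h2 (hχ0 t)
        _ ≤ (1 : ℝ) • J.bump κ z (t + s) := smul_le_smul_of_nonneg_right (hχ1 t) hB
        _ = _ := one_smul _ _
  have h1 : J.abs z ≤ I⁻¹ • J.bumpMean κ z + (κ + γ) • J.abs z := by
    refine J.abs_le fun d hd => ?_
    obtain ⟨s, hs⟩ := (homeomorphCircle (T := 1) one_ne_zero).surjective
      ⟨d, by simpa [Submonoid.unitSphere] using hd⟩
    rw [homeomorphCircle_apply] at hs
    have := key s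
    rw [hs, ← le_inv_smul_iff_of_pos hI0, sub_le_iff_le_add] at this
    exact this
  rw [mul_smul, ← le_inv_smul_iff_of_pos hI0]
  have e : γ • J.abs z = J.abs z - (κ + γ) • J.abs z := by
    have : γ = 1 - (κ + γ) := by simp only [hγ]; ring
    conv_lhs => rw [this]
    rw [sub_smul, one_smul]
  rw [e, sub_le_iff_le_add]
  exact h1

/-- The map `power` is bounded below by a multiple of `hullMean`, for a suitable parameter. -/
theorem exists_smul_hullMean_le_abs_power [CompleteSpace E] (n : ℤ) :
    ∃ κ δ : ℝ, 0 < κ ∧ κ ≤ 1 ∧ 0 < δ ∧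
      ∀ z : E, δ • J.hullMean κ z ≤ J.abs (J.power κ n z) := by
  set η : ℝ := 1 / (2 * (|(n : ℝ)| + 1)) with hη
  have hn : (0 : ℝ) ≤ |(n : ℝ)| := _root_.abs_nonneg _
  have hη0 : 0 < η := by positivity
  have hη1 : η ≤ 1 / 2 := by
    rw [hη]; exact one_div_le_one_div_of_le two_pos (by linarith)
  have hnη : |(n : ℝ)| * η ≤ 1 / 2 := by
    rw [hη, mul_one_div, div_le_div_iff₀ (by positivity) two_pos]; linarith
  set κ := √(1 - η ^ 2 / 4) with hκ
  have hκ0 : 0 < κ := Real.sqrt_pos.2 (by nlinarith)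
  have hκsq : κ ^ 2 = 1 - η ^ 2 / 4 := Real.sq_sqrt (by nlinarith)
  have hκ1 : κ < 1 := by nlinarith [sq_nonneg (κ - 1), pow_pos hη0 2]
  obtain ⟨δ, hδ, hδz⟩ := J.exists_smul_abs_le_bumpMean hκ0.le hκ1
  refine ⟨κ, δ / 4, hκ0, hκ1.le, by positivity, fun z => ?_⟩
  have h1 := J.smul_bumpMean_le_abs_power (κ := κ) n hnη (fun s t hst => ?_) z
  · have h2 := J.hullMean_le hκ1.le z
    calc (δ / 4) • J.hullMean κ z ≤ (δ / 4) • ((2 : ℝ) • J.abs z) :=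
          smul_le_smul_of_nonneg_left h2 (by positivity)
      _ = (1 / 2 : ℝ) • (δ • J.abs z) := by module
      _ ≤ (1 / 2 : ℝ) • J.bumpMean κ z := smul_le_smul_of_nonneg_left (hδz z) (by norm_num)
      _ ≤ _ := h1
  · have hp := parallelogram_law_with_norm ℝ (toCircle s : ℂ) (toCircle t : ℂ)
    rw [Circle.norm_coe, Circle.norm_coe] at hp
    refine abs_le_of_sq_le_sq' ?_ (by positivity) |>.2
    nlinarith

end Complexification

theorem exists_norm_le_mul_norm_smul_sub {E : Type*} [NormedAddCommGroup E] [NormedSpace ℂ E]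
    {T : E →L[ℂ] E} {β : ℂ} (hβ : β ∉ spectrum ℂ T) (hβ1 : ‖β‖ = 1) :
    ∃ M : ℝ, 0 ≤ M ∧ ∀ w : E, ‖w‖ ≤ M * ‖(β⁻¹ • T) w - w‖ := by
  rw [spectrum.notMem_iff] at hβ
  obtain ⟨R, hR⟩ := hβ.exists_left_inv
  refine ⟨‖R‖, norm_nonneg _, fun w => ?_⟩
  have hβ0 : β ≠ 0 := fun h => by simp [h] at hβ1
  have h1 : R (β • w - T w) = w := by
    have := congrArg (fun L : E →L[ℂ] E => L w) hR
    simpa [Algebra.algebraMap_eq_smul_one] using this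
  have h2 : ‖β • w - T w‖ = ‖(β⁻¹ • T) w - w‖ := by
    have : β • w - T w = -(β • ((β⁻¹ • T) w - w)) := by
      simp [smul_sub, smul_smul, hβ0]
    rw [this, norm_neg, norm_smul, hβ1, one_mul]
  calc ‖w‖ = ‖R (β • w - T w)‖ := by rw [h1]
    _ ≤ ‖R‖ * ‖β • w - T w‖ := R.le_opNorm _
    _ = _ := by rw [h2]

namespace Complexification

open AddCircle

variable {X E : Type*} [NormedAddCommGroup X] [Lattice X] [IsOrderedAddMonoid X] [HasSolidNorm X]
  [NormedSpace ℝ X] [IsOrderedModule ℝ X] [CompleteSpace X]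
  [NormedAddCommGroup E] [NormedSpace ℂ E] (J : Complexification X E)

section Iterates

variable {A : E →L[ℂ] E} {S : X →L[ℝ] X} (hS : ∀ x, 0 ≤ x → 0 ≤ S x)
  (hA : ∀ z, J.abs (A z) ≤ S (J.abs z))

include hS

omit [IsOrderedAddMonoid X] [HasSolidNorm X] [IsOrderedModule ℝ X] [CompleteSpace X] in
theorem pow_map_nonneg (k : ℕ) (x : X) (hx : 0 ≤ x) : 0 ≤ (S ^ k) x := by
  induction k with
  | zero => simpa using hx
  | succ k ih => rw [pow_succ']; exact hS _ ih

omit [HasSolidNorm X] [IsOrderedModule ℝ X] [CompleteSpace X] in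
theorem pow_map_mono (k : ℕ) {x y : X} (h : x ≤ y) : (S ^ k) x ≤ (S ^ k) y := by
  rw [← sub_nonneg, ← map_sub]
  exact pow_map_nonneg hS k _ (sub_nonneg.2 h)

include hA

theorem abs_pow_map_le (k : ℕ) (z : E) : J.abs ((A ^ k) z) ≤ (S ^ k) (J.abs z) := by
  induction k with
  | zero => simp
  | succ k ih =>
    rw [pow_succ', pow_succ', mul_apply_eq_comp, mul_apply_eq_comp]
    refine (hA _).trans ?_
    simpa only [pow_one] using pow_map_mono hS 1 ih

variable {s u : X} {p : E} (hs : s ≤ S s + u) (hp : J.abs (A p - p) ≤ S s - s + u)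

include hs hp

theorem abs_pow_map_sub_le {k N : ℕ} (hk : k ≤ N) :
    J.abs ((A ^ k) p - p) ≤ (S ^ N) s - s + ∑ j ∈ Finset.range N, (S ^ j) u := by
  have h1 : J.abs ((A ^ k) p - p) ≤ (S ^ k) s - s + ∑ j ∈ Finset.range k, (S ^ j) u := by
    clear hk
    induction k with
    | zero => simp
    | succ k ih =>
      have e : (A ^ (k + 1)) p - p = (A ^ k) (A p - p) + ((A ^ k) p - p) := by
        rw [pow_succ, map_sub]; simp
      rw [e, Finset.sum_range_succ]
      refine (J.abs_add_le _ _).trans ?_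
      refine (add_le_add ((J.abs_pow_map_le hS hA k _).trans (pow_map_mono hS k hp)) ih).trans ?_
      refine le_of_eq ?_
      rw [map_add, map_sub, pow_succ]
      simp only [mul_apply_eq_comp]
      abel
  refine h1.trans ?_
  clear h1
  induction N, hk using Nat.le_induction with
  | base => exact le_rfl
  | succ N hk ih =>
    refine ih.trans ?_
    have h2 := pow_map_mono hS N hs
    rw [map_add, ← sub_nonneg] at h2
    rw [Finset.sum_range_succ, ← sub_nonneg, pow_succ]
    refine h2.trans_eq ?_
    simp only [mul_apply_eq_comp]
    abel

/-- Cesàro means of the iterates of `A` show that an approximate fixed point of a power bounded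
map is small up to the defect `(S ^ N) s - s`. -/
theorem exists_abs_le_of_almost_fixed {M : ℝ} (hM : ∀ w : E, ‖w‖ ≤ M * ‖A w - w‖) {N : ℕ}
    (hN : 0 < N) : ∃ c : E, ‖c‖ ≤ M / N * ‖(A ^ N) p - p‖ ∧
      J.abs p ≤ J.abs c + ((S ^ N) s - s + ∑ j ∈ Finset.range N, (S ^ j) u) := by
  have hN' : (0 : ℝ) < N := by exact_mod_cast hN
  set B := (S ^ N) s - s + ∑ j ∈ Finset.range N, (S ^ j) u with hB
  set c : E := ((N : ℂ)⁻¹) • ∑ k ∈ Finset.range N, (A ^ k) p with hc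
  refine ⟨c, ?_, ?_⟩
  · have h1 : A (∑ k ∈ Finset.range N, (A ^ k) p) - ∑ k ∈ Finset.range N, (A ^ k) p =
        (A ^ N) p - p := by
      have := congrArg (fun L : E →L[ℂ] E => L p) (mul_neg_geom_sum A N)
      simp only [mul_apply_eq_comp, sub_apply,
        one_apply_eq_self, sum_apply] at this
      rw [← neg_sub, this, neg_sub]
    have h2 := hM (∑ k ∈ Finset.range N, (A ^ k) p)
    rw [h1] at h2
    rw [hc, norm_smul, norm_inv, Complex.norm_natCast, div_mul_eq_mul_div, div_eq_inv_mul]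
    exact mul_le_mul_of_nonneg_left h2 (by positivity)
  · have h1 : J.abs (p - c) ≤ B := by
      have hN0 : (N : ℂ) ≠ 0 := by exact_mod_cast hN.ne'
      have e : p - c = (N : ℂ)⁻¹ • ∑ k ∈ Finset.range N, (p - (A ^ k) p) := by
        rw [Finset.sum_sub_distrib, smul_sub, hc, Finset.sum_const, Finset.card_range,
          ← Nat.cast_smul_eq_nsmul ℂ, smul_smul, inv_mul_cancel₀ hN0, one_smul]
      rw [e]
      refine (J.abs_smul_le _ _).trans ?_
      rw [norm_inv, Complex.norm_natCast, inv_smul_le_iff_of_pos hN']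
      refine (J.abs_sum_le _ _).trans ?_
      refine (Finset.sum_le_card_nsmul _ _ B fun k hk => ?_).trans_eq ?_
      · rw [J.abs_sub_rev]
        exact J.abs_pow_map_sub_le hS hA hs hp (Finset.mem_range.1 hk).le
      · rw [Finset.card_range, Nat.cast_smul_eq_nsmul]
    calc J.abs p = J.abs (c + (p - c)) := by rw [add_sub_cancel]
      _ ≤ J.abs c + J.abs (p - c) := J.abs_add_le _ _
      _ ≤ _ := add_le_add le_rfl h1

end Iterates

end Complexification

theorem ContinuousLinearMap.tendsto_pow_sub_self {ι X : Type*} [NormedAddCommGroup X]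
    [NormedSpace ℝ X] (S : X →L[ℝ] X) {l : Filter ι} {g : ι → X}
    (hg : Tendsto (fun r => S (g r) - g r) l (𝓝 0)) (N : ℕ) :
    Tendsto (fun r => (S ^ N) (g r) - g r) l (𝓝 0) := by
  induction N with
  | zero => simpa using tendsto_const_nhds
  | succ N ih =>
    have h := ((S.continuous.tendsto 0).comp ih).add hg
    rw [map_zero, add_zero] at h
    refine h.congr fun r => ?_
    simp [pow_succ']

namespace Complexification

open AddCircle

variable {X E : Type*} [NormedAddCommGroup X] [Lattice X] [IsOrderedAddMonoid X] [HasSolidNorm X]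
  [NormedSpace ℝ X] [IsOrderedModule ℝ X] [CompleteSpace X]
  [NormedAddCommGroup E] [NormedSpace ℂ E] (J : Complexification X E)

/-- One step of the contraction argument: an almost majorant `t • g` of `s` is improved
to `(t / (1 + δ)) • g`. -/
theorem exists_le_smul_add_of_le_smul_add {A : E →L[ℂ] E} {S : X →L[ℝ] X}
    (hS : ∀ x, 0 ≤ x → 0 ≤ S x) (hA : ∀ z, J.abs (A z) ≤ S (J.abs z))
    {s u g w : X} {p : E} (hs : s ≤ S s + u) (hp : J.abs (A p - p) ≤ S s - s + u)
    {M : ℝ} (hM0 : 0 ≤ M) (hM : ∀ w : E, ‖w‖ ≤ M * ‖A w - w‖) {N : ℕ} (hN : 0 < N)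
    {δ t L : ℝ} (hδ : 0 < δ) (ht : 0 ≤ t) (hL : 0 ≤ L) (hsp : δ • s ≤ J.abs p)
    (hpg : J.abs p ≤ L • g) (hsg : s ≤ t • g + w) :
    ∃ w' : X, ‖w'‖ ≤ t * ‖(S ^ N) g - g‖ + ‖S ^ N‖ * ‖w‖ +
        2 * ‖J.re‖ * (M / N * (2 * ‖J.ι‖ * (L * (2 * ‖g‖ + ‖(S ^ N) g - g‖)))) +
        ‖∑ j ∈ Finset.range N, (S ^ j) u‖ ∧
      s ≤ (t / (1 + δ)) • g + w' := by
  obtain ⟨c, hc, hpc⟩ := J.exists_abs_le_of_almost_fixed hS hA hs hp hM hN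
  set U := ∑ j ∈ Finset.range N, (S ^ j) u
  set v := t • ((S ^ N) g - g) + (S ^ N) w + J.abs c + U with hv
  have hδ1 : (0 : ℝ) < 1 + δ := by linarith
  refine ⟨(1 + δ)⁻¹ • v, ?_, ?_⟩
  · have hpN : ‖J.abs ((A ^ N) p)‖ ≤ L * (‖g‖ + ‖(S ^ N) g - g‖) := by
      have h1 : J.abs ((A ^ N) p) ≤ L • (S ^ N) g := by
        rw [← map_smul]
        exact (J.abs_pow_map_le hS hA N p).trans (pow_map_mono hS N hpg)
      refine (norm_le_norm_of_nonneg_of_le (J.abs_nonneg _) h1).trans ?_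
      rw [norm_smul, Real.norm_of_nonneg hL]
      refine mul_le_mul_of_nonneg_left ?_ hL
      simpa using norm_add_le g ((S ^ N) g - g)
    have hp0 : ‖J.abs p‖ ≤ L * ‖g‖ := by
      refine (norm_le_norm_of_nonneg_of_le (J.abs_nonneg _) hpg).trans ?_
      rw [norm_smul, Real.norm_of_nonneg hL]
    have hdiff : ‖(A ^ N) p - p‖ ≤ 2 * ‖J.ι‖ * (L * (2 * ‖g‖ + ‖(S ^ N) g - g‖)) := by
      refine (norm_sub_le _ _).trans ?_
      have h1 := (J.norm_le ((A ^ N) p)).trans (mul_le_mul_of_nonneg_left hpN (by positivity))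
      have h2 := (J.norm_le p).trans (mul_le_mul_of_nonneg_left hp0 (by positivity))
      linarith
    have hc' : ‖J.abs c‖ ≤
        2 * ‖J.re‖ * (M / N * (2 * ‖J.ι‖ * (L * (2 * ‖g‖ + ‖(S ^ N) g - g‖)))) := by
      refine (J.norm_abs_le c).trans (mul_le_mul_of_nonneg_left (hc.trans ?_) (by positivity))
      exact mul_le_mul_of_nonneg_left hdiff (by positivity)
    have hvn : ‖(1 + δ)⁻¹ • v‖ ≤ ‖v‖ := by
      rw [norm_smul, Real.norm_of_nonneg (by positivity)]
      refine mul_le_of_le_one_left (norm_nonneg _) (inv_le_one_of_one_le₀ (by linarith))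
    refine hvn.trans ((norm_add_le _ _).trans (add_le_add ?_ le_rfl))
    refine (norm_add_le _ _).trans (add_le_add ?_ hc')
    refine (norm_add_le _ _).trans (add_le_add ?_ ((S ^ N).le_opNorm w))
    rw [norm_smul, Real.norm_of_nonneg ht]
  · have h1 : (S ^ N) s ≤ t • (S ^ N) g + (S ^ N) w := by
      rw [← map_smul, ← map_add]
      exact pow_map_mono hS N hsg
    have h2 : (1 + δ) • s ≤ t • g + v := by
      have h3 := (hsp.trans hpc)
      rw [add_smul, one_smul]
      calc s + δ • s ≤ s + (J.abs c + ((S ^ N) s - s + U)) := add_le_add le_rfl h3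
        _ = (S ^ N) s + (J.abs c + U) := by abel
        _ ≤ t • (S ^ N) g + (S ^ N) w + (J.abs c + U) := add_le_add h1 le_rfl
        _ = t • g + v := by rw [hv, smul_sub]; abel
    rw [div_eq_inv_mul, mul_smul, ← smul_add]
    exact (le_inv_smul_iff_of_pos hδ1).2 h2

/-- If `α` is an approximate eigenvalue of `T` with approximate eigenvectors dominated by
bounded approximate fixed vectors, then all powers of `α` belong to the spectrum. -/
theorem zpow_mem_spectrum_of_approx_eigenvectors [CompleteSpace E] {T : E →L[ℂ] E}
    {S : X →L[ℝ] X} (hS : ∀ x, 0 ≤ x → 0 ≤ S x) (hTS : ∀ z, J.re (T z) = S (J.re z))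
    (hTι : ∀ x, T (J.ι x) = J.ι (S x)) {ι : Type*} {l : Filter ι} [l.NeBot] {f : ι → E}
    {g : ι → X} {K G c : ℝ} {α : ℂ} (hα : ‖α‖ = 1) (hK : 0 ≤ K)
    (hfg : ∀ᶠ r in l, J.abs (f r) ≤ K • g r) (hg : ∀ᶠ r in l, ‖g r‖ ≤ G)
    (hf : Tendsto (fun r => T (f r) - α • f r) l (𝓝 0))
    (hSg : Tendsto (fun r => S (g r) - g r) l (𝓝 0)) (hc : 0 < c)
    (hfc : ∀ᶠ r in l, c ≤ ‖f r‖) (n : ℤ) : α ^ n ∈ spectrum ℂ T := by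
  by_contra hspec
  obtain ⟨t₀, ht₀⟩ := (homeomorphCircle (T := 1) one_ne_zero).surjective
    ⟨α, by simpa [Submonoid.unitSphere] using hα⟩
  rw [homeomorphCircle_apply] at ht₀
  replace ht₀ : (toCircle t₀ : ℂ) = α := by rw [ht₀]
  have hβ : phase n t₀ = α ^ n := by rw [phase_eq_zpow, ht₀]
  have hβ1 : ‖α ^ n‖ = 1 := by rw [← hβ, norm_phase]
  have hβ0 : α ^ n ≠ 0 := fun h => by simp [h] at hβ1
  obtain ⟨M, hM0, hM⟩ := exists_norm_le_mul_norm_smul_sub hspec hβ1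
  set A : E →L[ℂ] E := (α ^ n)⁻¹ • T with hAdef
  have hA : ∀ z, J.abs (A z) ≤ S (J.abs z) := fun z => by
    have : A z = (α ^ n)⁻¹ • T z := rfl
    rw [this, J.abs_smul_of_norm_eq_one (by rw [norm_inv, hβ1, inv_one])]
    exact J.abs_map_le T hS hTS z
  obtain ⟨κ, δ, hκ0, hκ1, hδ, hpow⟩ := J.exists_smul_hullMean_le_abs_power n
  set s : ι → X := fun r => J.hullMean κ (f r) with hsdef
  set p : ι → E := fun r => J.power κ n (f r) with hpdef
  set u : ι → X := fun r => (8 : ℝ) • J.abs (T (f r) - α • f r) with hudef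
  have hp : ∀ r, J.abs (A (p r) - p r) ≤ S (s r) - s r + u r := by
    intro r
    have e1 : A (p r) - p r = (α ^ n)⁻¹ • (T (p r) - α ^ n • p r) := by
      rw [smul_sub, inv_smul_smul₀ hβ0]; rfl
    have e2 : α ^ n • p r = J.power κ n (α • f r) := by
      rw [← hβ, ← J.power_toCircle_smul, ht₀]
    have e3 : s r = J.hullMean κ (α • f r) := by rw [← ht₀, J.hullMean_toCircle_smul]
    have h1 := J.abs_map_power_sub_le hκ0.le n T hS hTS hTι (f r)
    have h2 := J.abs_power_sub_le hκ0.le hκ1 n (T (f r)) (α • f r)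
    have h3 := J.hullMean_le_add hκ0.le hκ1 (α • f r) (T (f r))
    rw [← e3, J.abs_sub_rev (α • f r)] at h3
    rw [e1, J.abs_smul_of_norm_eq_one (by rw [norm_inv, hβ1, inv_one]), e2,
      ← sub_add_sub_cancel _ (J.power κ n (T (f r)))]
    refine (J.abs_add_le _ _).trans ((add_le_add h1 h2).trans ?_)
    rw [← sub_nonneg] at h3 ⊢
    refine h3.trans_eq ?_
    simp only [hudef]
    module
  have hs : ∀ r, s r ≤ S (s r) + u r := fun r => by
    have := (J.abs_nonneg _).trans (hp r)
    rwa [sub_add_eq_add_sub, sub_nonneg] at this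
  have hps : ∀ r, J.abs (p r) ≤ s r := fun r =>
    (J.abs_power_le n _).trans (J.bumpMean_le_hullMean hκ0.le _)
  have hsK : ∀ᶠ r in l, s r ≤ (2 * K) • g r := by
    filter_upwards [hfg] with r hr
    rw [mul_smul]
    exact (J.hullMean_le hκ1 _).trans (smul_le_smul_of_nonneg_left hr two_pos.le)
  have hu0 : Tendsto u l (𝓝 0) := by
    have h := (J.continuous_abs.tendsto 0).comp hf
    rw [J.abs_zero] at h
    simpa using h.const_smul (8 : ℝ)
  have hU : ∀ N : ℕ, Tendsto (fun r => ‖∑ j ∈ Finset.range N, (S ^ j) (u r)‖) l (𝓝 0) := by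
    intro N
    have h : Tendsto (fun r => ∑ j ∈ Finset.range N, (S ^ j) (u r)) l
        (𝓝 (∑ j ∈ Finset.range N, (S ^ j) 0)) :=
      tendsto_finsetSum _ fun j _ => ((S ^ j).continuous.tendsto 0).comp hu0
    simpa using h.norm
  have hSN : ∀ N : ℕ, Tendsto (fun r => ‖(S ^ N) (g r) - g r‖) l (𝓝 0) := fun N => by
    simpa using (S.tendsto_pow_sub_self hSg N).norm
  have step : ∀ t : ℝ, 0 ≤ t →
      (∀ ε > 0, ∀ᶠ r in l, ∃ w, ‖w‖ ≤ ε ∧ s r ≤ t • g r + w) →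
      ∀ ε > 0, ∀ᶠ r in l, ∃ w, ‖w‖ ≤ ε ∧ s r ≤ (t / (1 + δ)) • g r + w := by
    intro t ht hP ε hε
    set C := 2 * ‖J.re‖ * (M * (2 * ‖J.ι‖ * (2 * K * (2 * G + 1)))) with hC
    obtain ⟨N, hN⟩ := exists_nat_gt (max 0 (C / (ε / 4)))
    have hN0 : (0 : ℝ) < N := (le_max_left _ _).trans_lt hN
    have hCN : C / N ≤ ε / 4 := by
      have := (le_max_right _ _).trans hN.le
      rw [div_le_iff₀ (by positivity)] at this
      rw [div_le_iff₀ hN0]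
      linarith
    have e1 : ∀ᶠ r in l, ‖(S ^ N) (g r) - g r‖ ≤ 1 := (hSN N).eventually_le_const one_pos
    have e2 : ∀ᶠ r in l, ‖(S ^ N) (g r) - g r‖ ≤ ε / (4 * (t + 1)) :=
      (hSN N).eventually_le_const (by positivity)
    have e3 := (hU N).eventually_le_const (show 0 < ε / 4 by positivity)
    have e4 := hP (ε / (4 * (‖S ^ N‖ + 1))) (by positivity)
    filter_upwards [e1, e2, e3, e4, hsK, hg] with r h1 h2 h3 ⟨w, hw, hsw⟩ h5 h6
    obtain ⟨w', hw', hsw'⟩ := J.exists_le_smul_add_of_le_smul_add hS hA (hs r) (hp r) hM0 hM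
      (Nat.cast_pos.1 hN0) hδ ht (show 0 ≤ 2 * K by positivity) (hpow (f r)) ((hps r).trans h5) hsw
    refine ⟨w', hw'.trans ?_, hsw'⟩
    have i1 : t * ‖(S ^ N) (g r) - g r‖ ≤ ε / 4 := by
      calc _ ≤ (t + 1) * (ε / (4 * (t + 1))) :=
            mul_le_mul (by linarith) h2 (norm_nonneg _) (by positivity)
        _ = ε / 4 := by field_simp
    have i2 : ‖S ^ N‖ * ‖w‖ ≤ ε / 4 := by
      calc _ ≤ (‖S ^ N‖ + 1) * (ε / (4 * (‖S ^ N‖ + 1))) :=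
            mul_le_mul (by linarith) hw (norm_nonneg _) (by positivity)
        _ = ε / 4 := by field_simp
    have i3 : 2 * ‖J.re‖ * (M / N * (2 * ‖J.ι‖ * (2 * K * (2 * ‖g r‖ +
        ‖(S ^ N) (g r) - g r‖)))) ≤ C / N := by
      calc _ ≤ 2 * ‖J.re‖ * (M / N * (2 * ‖J.ι‖ * (2 * K * (2 * G + 1)))) := by gcongr
        _ = C / N := by rw [hC]; ring
    linarith
  have hiter : ∀ k : ℕ, ∀ ε > 0, ∀ᶠ r in l,
      ∃ w, ‖w‖ ≤ ε ∧ s r ≤ (2 * K / (1 + δ) ^ k) • g r + w := by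
    intro k
    induction k with
    | zero =>
      intro ε hε
      filter_upwards [hsK] with r hr
      exact ⟨0, by simpa using hε.le, by simpa using hr⟩
    | succ k ih =>
      have := step _ (by positivity) ih
      rwa [div_div, ← pow_succ] at this
  have hlim : Tendsto (fun k : ℕ => 2 * K / (1 + δ) ^ k * G) atTop (𝓝 0) := by
    have := ((tendsto_pow_atTop_nhds_zero_of_lt_one (r := (1 + δ)⁻¹) (by positivity)
      (inv_lt_one_of_one_lt₀ (by linarith))).const_mul (2 * K)).mul_const G
    simpa [div_eq_mul_inv] using this
  set η := κ * c / (4 * (2 * ‖J.ι‖ + 1)) with hη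
  have hη0 : 0 < η := by positivity
  obtain ⟨k, hk⟩ := (hlim.eventually_le_const hη0).exists
  obtain ⟨r, ⟨w, hw, hsw⟩, hgr, hcr⟩ := ((hiter k η hη0).and (hg.and hfc)).exists
  have h1 : ‖J.abs (f r)‖ * κ ≤ 2 * η := by
    have h2 : κ • J.abs (f r) ≤ (2 * K / (1 + δ) ^ k) • g r + w :=
      (J.smul_abs_le_hullMean hκ0.le _).trans hsw
    have h3 := norm_le_norm_of_nonneg_of_le (smul_nonneg hκ0.le (J.abs_nonneg _)) h2
    rw [norm_smul, Real.norm_of_nonneg hκ0.le] at h3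
    have h4 := norm_add_le ((2 * K / (1 + δ) ^ k) • g r) w
    rw [norm_smul, Real.norm_of_nonneg (by positivity)] at h4
    have h5 : 2 * K / (1 + δ) ^ k * ‖g r‖ ≤ 2 * K / (1 + δ) ^ k * G :=
      mul_le_mul_of_nonneg_left hgr (by positivity)
    linarith
  have h2 := hcr.trans (J.norm_le (f r))
  have h3 : c * κ ≤ 2 * ‖J.ι‖ * (2 * η) := by
    calc c * κ ≤ 2 * ‖J.ι‖ * ‖J.abs (f r)‖ * κ := mul_le_mul_of_nonneg_right h2 hκ0.le
      _ = 2 * ‖J.ι‖ * (‖J.abs (f r)‖ * κ) := by ring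
      _ ≤ _ := mul_le_mul_of_nonneg_left h1 (by positivity)
  have h4 : 4 * (2 * ‖J.ι‖ + 1) * η = κ * c := by rw [hη]; field_simp
  nlinarith [norm_nonneg J.ι, mul_pos hκ0 hc, mul_nonneg (norm_nonneg J.ι) hη0.le]

end Complexification

section Resolvent

variable {E : Type*} [NormedAddCommGroup E] [NormedSpace ℂ E] [CompleteSpace E] {T : E →L[ℂ] E}
  {μ : ℂ}

theorem summable_norm_inv_pow_smul_pow (h : spectralRadius ℂ T < ‖μ‖₊) :
    Summable fun k : ℕ => ‖(μ⁻¹ • T) ^ k‖ := by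
  obtain ⟨ρ, hρ1, hρ2⟩ := ENNReal.lt_iff_exists_nnreal_btwn.1 h
  rw [ENNReal.coe_lt_coe] at hρ2
  have hμ : 0 < ‖μ‖₊ := pos_of_gt hρ2
  have hT := spectrum.pow_nnnorm_pow_one_div_tendsto_nhds_spectralRadius T
  have hev : ∀ᶠ k : ℕ in atTop, ‖(μ⁻¹ • T) ^ k‖ ≤ ((ρ / ‖μ‖₊ : NNReal) : ℝ) ^ k := by
    filter_upwards [hT.eventually_lt_const hρ1, eventually_gt_atTop 0] with k hk hk0
    have hk' : (0 : ℝ) < k := by exact_mod_cast hk0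
    rw [one_div, ENNReal.rpow_inv_lt_iff hk', ENNReal.rpow_natCast] at hk
    have hk1 : ‖T ^ k‖₊ < ρ ^ k := by exact_mod_cast hk
    have hk2 : ‖T ^ k‖ ≤ (ρ : ℝ) ^ k := by exact_mod_cast hk1.le
    rw [smul_pow, norm_smul, norm_pow, norm_inv, NNReal.coe_div, div_pow, coe_nnnorm, inv_pow,
      div_eq_inv_mul]
    exact mul_le_mul_of_nonneg_left hk2 (by positivity)
  have hlt : ((ρ / ‖μ‖₊ : NNReal) : ℝ) < 1 := by
    rw [← NNReal.coe_one, NNReal.coe_lt_coe, div_lt_one hμ]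
    exact hρ2
  refine Summable.of_norm_bounded_eventually_nat
    (summable_geometric_of_lt_one (NNReal.coe_nonneg _) hlt) ?_
  simpa using hev

/-- The Neumann series of the resolvent converges outside the spectral disc. -/
theorem hasSum_resolvent (h : spectralRadius ℂ T < ‖μ‖₊) :
    HasSum (fun k : ℕ => μ⁻¹ • (μ⁻¹ • T) ^ k) (resolvent T μ) := by
  have hμ : μ ≠ 0 := by
    rintro rfl
    simp at h
  have hs := summable_norm_inv_pow_smul_pow h
  have hsum := hs.of_norm
  set Q := ∑' k : ℕ, (μ⁻¹ • T) ^ k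
  have h1 : (1 - μ⁻¹ • T) * Q = 1 := hsum.one_sub_mul_tsum_pow
  have hres : IsUnit (algebraMap ℂ (E →L[ℂ] E) μ - T) :=
    spectrum.mem_resolventSet_of_spectralRadius_lt h
  have h2 : (algebraMap ℂ (E →L[ℂ] E) μ - T) * (μ⁻¹ • Q) = 1 := by
    have e : algebraMap ℂ (E →L[ℂ] E) μ - T = μ • (1 - μ⁻¹ • T) := by
      rw [smul_sub, smul_inv_smul₀ hμ, Algebra.algebraMap_eq_smul_one]
    rw [e, smul_mul_smul_comm, h1, mul_inv_cancel₀ hμ, one_smul]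
  have h3 : resolvent T μ = μ⁻¹ • Q := by
    rw [resolvent, ← mul_one (Ring.inverse _), ← h2, ← mul_assoc,
      Ring.inverse_mul_cancel _ hres, one_mul]
  rw [h3]
  exact hsum.hasSum.const_smul _

omit [CompleteSpace E] in
theorem map_resolvent_apply (hμ : μ ∈ resolventSet ℂ T) (z : E) :
    T (resolvent T μ z) = μ • resolvent T μ z - z := by
  have h := Ring.mul_inverse_cancel _ hμ
  have h1 := congrArg (fun L : E →L[ℂ] E => L z) h
  have h2 : μ • resolvent T μ z - T (resolvent T μ z) = z := by
    simpa [Algebra.algebraMap_eq_smul_one, resolvent] using h1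
  exact (sub_eq_of_eq_add' (sub_eq_iff_eq_add.1 h2)).symm

theorem one_le_norm_resolvent_mul_norm_sub {α : ℂ} (hα : α ∈ spectrum ℂ T)
    (hμ : μ ∈ resolventSet ℂ T) : 1 ≤ ‖resolvent T μ‖ * ‖μ - α‖ := by
  by_contra! hlt
  refine hα ?_
  obtain ⟨x, hx⟩ := hμ
  have hR : resolvent T μ = ((x⁻¹ : (E →L[ℂ] E)ˣ) : E →L[ℂ] E) := by
    rw [resolvent, ← hx, Ring.inverse_unit]
  rcases subsingleton_or_nontrivial (E →L[ℂ] E) with hsub | hnon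
  · exact isUnit_of_subsingleton _
  have hpos : 0 < ‖((x⁻¹ : (E →L[ℂ] E)ˣ) : E →L[ℂ] E)‖ := Units.norm_pos _
  have hlt' : ‖(algebraMap ℂ (E →L[ℂ] E) α - T) - x‖ <
      ‖((x⁻¹ : (E →L[ℂ] E)ˣ) : E →L[ℂ] E)‖⁻¹ := by
    rw [hx, sub_sub_sub_cancel_right, ← map_sub]
    rw [norm_sub_rev μ α, hR] at hlt
    rw [Algebra.algebraMap_eq_smul_one, norm_smul, ← one_div, lt_div_iff₀ hpos]
    have := ContinuousLinearMap.norm_id_le (𝕜 := ℂ) (E := E)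
    have h1 : ‖(1 : E →L[ℂ] E)‖ ≤ 1 := this
    refine lt_of_le_of_lt ?_ hlt
    rw [mul_comm]
    exact mul_le_mul_of_nonneg_left (mul_le_of_le_one_right (norm_nonneg _) h1) hpos.le
  exact (Units.ofNearby x _ hlt').isUnit

end Resolvent

namespace Complexification

variable {X E : Type*} [NormedAddCommGroup X] [Lattice X] [IsOrderedAddMonoid X] [HasSolidNorm X]
  [NormedSpace ℝ X] [IsOrderedModule ℝ X] [CompleteSpace X]
  [NormedAddCommGroup E] [NormedSpace ℂ E] [CompleteSpace E] (J : Complexification X E)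
  {T : E →L[ℂ] E} {S : X →L[ℝ] X}

/-- The resolvent at `μ` is dominated by the resolvent at `‖μ‖`. -/
theorem abs_resolvent_apply_le (hS : ∀ x, 0 ≤ x → 0 ≤ S x)
    (hTS : ∀ z, J.re (T z) = S (J.re z)) {μ : ℂ} (h : spectralRadius ℂ T < ‖μ‖₊) (z : E) :
    J.abs (resolvent T μ z) ≤ J.re (resolvent T (‖μ‖ : ℂ) (J.ι (J.abs z))) := by
  have h' : spectralRadius ℂ T < ‖((‖μ‖ : ℝ) : ℂ)‖₊ := by
    have : ‖((‖μ‖ : ℝ) : ℂ)‖₊ = ‖μ‖₊ := NNReal.eq (by simp)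
    rwa [this]
  have h1 : HasSum (fun k : ℕ => (μ⁻¹ • (μ⁻¹ • T) ^ k) z) (resolvent T μ z) :=
    (hasSum_resolvent h).mapL (ContinuousLinearMap.apply ℂ E z)
  have h2 : HasSum (fun k : ℕ => ((‖μ‖ : ℂ)⁻¹ • ((‖μ‖ : ℂ)⁻¹ • T) ^ k) (J.ι (J.abs z)))
      (resolvent T (‖μ‖ : ℂ) (J.ι (J.abs z))) :=
    (hasSum_resolvent h').mapL (ContinuousLinearMap.apply ℂ E (J.ι (J.abs z)))
  have h3 := h2.mapL J.re
  have hA : ∀ z, J.abs (T z) ≤ S (J.abs z) := J.abs_map_le T hS hTS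
  have hpow : ∀ (k : ℕ) z, J.re ((T ^ k) z) = (S ^ k) (J.re z) := by
    intro k
    induction k with
    | zero => simp
    | succ k ih => intro z; rw [pow_succ', pow_succ', mul_apply_eq_comp, mul_apply_eq_comp, hTS, ih]
  refine le_of_tendsto_of_tendsto' ((J.continuous_abs.tendsto _).comp h1.tendsto_sum_nat)
    h3.tendsto_sum_nat fun N => ?_
  refine (J.abs_sum_le _ _).trans (Finset.sum_le_sum fun k _ => ?_)
  have e1 : (μ⁻¹ • (μ⁻¹ • T) ^ k) z = (μ⁻¹ ^ (k + 1)) • (T ^ k) z := by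
    rw [smul_pow, smul_smul, ← pow_succ']; rfl
  have e2 : J.re (((‖μ‖ : ℂ)⁻¹ • ((‖μ‖ : ℂ)⁻¹ • T) ^ k) (J.ι (J.abs z))) =
      (‖μ‖⁻¹ ^ (k + 1)) • (S ^ k) (J.abs z) := by
    rw [smul_pow, smul_smul, ← pow_succ', ← Complex.ofReal_inv, ← Complex.ofReal_pow]
    change J.re (((‖μ‖⁻¹ ^ (k + 1) : ℝ) : ℂ) • (T ^ k) (J.ι (J.abs z))) = _
    rw [Complex.coe_smul, map_smul, hpow, J.re_ι]
  rw [e1, e2]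
  refine (J.abs_smul_le _ _).trans ?_
  rw [norm_pow, norm_inv]
  exact smul_le_smul_of_nonneg_left (J.abs_pow_map_le hS hA k z) (by positivity)

theorem zpow_mem_spectrum_of_limsup_resolvent_pos (hS : ∀ x, 0 ≤ x → 0 ≤ S x)
    (hTS : ∀ z, J.re (T z) = S (J.re z)) (hTι : ∀ x, T (J.ι x) = J.ι (S x))
    (hr : spectralRadius ℂ T = 1) {α : ℂ} (hα : ‖α‖ = 1) (hαT : α ∈ spectrum ℂ T)
    (hlim : 0 < limsup (fun r : ℝ => ‖resolvent T ((r : ℂ) * α)‖ / ‖resolvent T (r : ℂ)‖)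
      (𝓝[>] 1)) (n : ℤ) : α ^ n ∈ spectrum ℂ T := by
  set ratio : ℝ → ℝ := fun r => ‖resolvent T ((r : ℂ) * α)‖ / ‖resolvent T (r : ℂ)‖ with hratio
  set a : ℝ → ℝ := fun r => ‖resolvent T (r : ℂ)‖ with ha
  have hnorm : ∀ r : ℝ, 1 < r → ‖(r : ℂ) * α‖ = r := fun r hr1 => by
    rw [norm_mul, hα, mul_one, Complex.norm_real, Real.norm_of_nonneg (by linarith)]
  have hout : ∀ μ : ℂ, 1 < ‖μ‖ → spectralRadius ℂ T < ‖μ‖₊ := fun μ hμ => by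
    rw [hr]; exact_mod_cast hμ
  have hmem : ∀ μ : ℂ, 1 < ‖μ‖ → μ ∈ resolventSet ℂ T := fun μ hμ =>
    spectrum.mem_resolventSet_of_spectralRadius_lt (hout μ hμ)
  have hdom : ∀ r : ℝ, 1 < r → ∀ z, J.abs (resolvent T ((r : ℂ) * α) z) ≤
      J.re (resolvent T (r : ℂ) (J.ι (J.abs z))) := fun r hr1 z => by
    have h := J.abs_resolvent_apply_le hS hTS (hout ((r : ℂ) * α) (by rwa [hnorm r hr1])) z
    rwa [hnorm r hr1] at h
  set G := ‖J.re‖ * (‖J.ι‖ * (2 * ‖J.re‖)) with hG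
  have hgnorm : ∀ (r : ℝ) (z : E),
      ‖J.re (resolvent T (r : ℂ) (J.ι (J.abs z)))‖ ≤ a r * (G * ‖z‖) := fun r z => by
    calc _ ≤ ‖J.re‖ * (a r * (‖J.ι‖ * (2 * ‖J.re‖ * ‖z‖))) := by
          refine J.re.le_opNorm_of_le (ContinuousLinearMap.le_opNorm_of_le _ ?_)
          exact J.ι.le_opNorm_of_le (J.norm_abs_le z)
      _ = _ := by rw [hG]; ring
  have hK : ∀ r : ℝ, 1 < r → 1 ≤ 2 * ‖J.ι‖ * G * (r - 1) * a r := by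
    intro r hr1
    have h1 : ‖resolvent T ((r : ℂ) * α)‖ ≤ 2 * ‖J.ι‖ * G * a r := by
      refine ContinuousLinearMap.opNorm_le_bound _ (by positivity) fun z => ?_
      refine (J.norm_le _).trans ?_
      have h2 := (norm_le_norm_of_nonneg_of_le (J.abs_nonneg _) (hdom r hr1 z)).trans (hgnorm r z)
      calc _ ≤ 2 * ‖J.ι‖ * (a r * (G * ‖z‖)) := mul_le_mul_of_nonneg_left h2 (by positivity)
        _ = _ := by ring
    have h2 := one_le_norm_resolvent_mul_norm_sub hαT (hmem ((r : ℂ) * α) (by rwa [hnorm r hr1]))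
    have h3 : ‖(r : ℂ) * α - α‖ = r - 1 := by
      have : (r : ℂ) * α - α = ((r - 1 : ℝ) : ℂ) * α := by push_cast; ring
      rw [this, norm_mul, hα, mul_one, Complex.norm_real, Real.norm_of_nonneg (by linarith)]
    rw [h3] at h2
    calc 1 ≤ _ := h2
      _ ≤ 2 * ‖J.ι‖ * G * a r * (r - 1) := mul_le_mul_of_nonneg_right h1 (by linarith)
      _ = _ := by ring
  have ha0 : ∀ r : ℝ, 1 < r → 0 < a r := fun r hr1 => by
    refine (norm_nonneg _).lt_of_ne' fun h => ?_
    have := hK r hr1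
    simp only [ha] at this
    rw [h] at this
    norm_num at this
  have hainv : ∀ r : ℝ, 1 < r → (a r)⁻¹ ≤ 2 * ‖J.ι‖ * G * (r - 1) := fun r hr1 => by
    rw [inv_le_iff_one_le_mul₀ (ha0 r hr1)]; exact hK r hr1
  obtain ⟨c, hc0, hc⟩ := exists_between hlim
  have hfreq : ∃ᶠ r in 𝓝[>] (1 : ℝ), c < ratio r :=
    frequently_lt_of_lt_limsup (isCoboundedUnder_le_of_le _ (x := 0) fun r => by positivity) hc
  have hne := frequently_iff_neBot.1 hfreq
  set l := 𝓝[>] (1 : ℝ) ⊓ 𝓟 {r | c < ratio r} with hl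
  have hl1 : ∀ᶠ r in l, 1 < r := Filter.Eventually.filter_mono inf_le_left self_mem_nhdsWithin
  have hlc : ∀ᶠ r in l, c < ratio r :=
    Filter.Eventually.filter_mono inf_le_right (mem_principal_self _)
  have hex : ∀ r : ℝ, ∃ z : E, ‖z‖ ≤ 1 ∧
      (1 < r → c < ratio r → c * a r ≤ ‖resolvent T ((r : ℂ) * α) z‖) := by
    intro r
    by_cases h : 1 < r ∧ c < ratio r
    · have h1 : c * a r < ‖resolvent T ((r : ℂ) * α)‖ := (lt_div_iff₀ (ha0 r h.1)).1 h.2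
      obtain ⟨z, hz, hz'⟩ := ContinuousLinearMap.exists_lt_apply_of_lt_opNorm _ h1
      exact ⟨z, hz.le, fun _ _ => hz'.le⟩
    · exact ⟨0, by simp, fun h1 h2 => absurd ⟨h1, h2⟩ h⟩
  choose z hz hzc using hex
  have hG0 : 0 ≤ G := by positivity
  have hgG : ∀ r : ℝ, 1 < r →
      ‖(a r)⁻¹ • J.re (resolvent T (r : ℂ) (J.ι (J.abs (z r))))‖ ≤ G := fun r hr1 => by
    rw [norm_smul, norm_inv, Real.norm_of_nonneg (ha0 r hr1).le, inv_mul_le_iff₀ (ha0 r hr1)]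
    exact (hgnorm r (z r)).trans (mul_le_mul_of_nonneg_left
      (mul_le_of_le_one_right hG0 (hz r)) (ha0 r hr1).le)
  have hdom' : ∀ r : ℝ, 1 < r → J.abs (((a r)⁻¹ : ℂ) • resolvent T ((r : ℂ) * α) (z r)) ≤
      (1 : ℝ) • ((a r)⁻¹ • J.re (resolvent T (r : ℂ) (J.ι (J.abs (z r))))) := fun r hr1 => by
    refine (J.abs_smul_le _ _).trans ?_
    rw [one_smul, norm_inv, Complex.norm_real, Real.norm_of_nonneg (ha0 r hr1).le]
    exact smul_le_smul_of_nonneg_left (hdom r hr1 _) (inv_nonneg.2 (ha0 r hr1).le)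
  have htend : ∀ C : ℝ, Tendsto (fun r : ℝ => C * (r - 1)) l (𝓝 0) := fun C => by
    have : Tendsto (fun r : ℝ => C * (r - 1)) (𝓝 1) (𝓝 (C * (1 - 1))) :=
      (continuous_const.mul (continuous_id.sub continuous_const)).tendsto 1
    rw [sub_self, mul_zero] at this
    exact this.mono_left (inf_le_left.trans nhdsWithin_le_nhds)
  refine J.zpow_mem_spectrum_of_approx_eigenvectors hS hTS hTι (l := l) hα zero_le_one
    (hl1.mono hdom') (hl1.mono hgG) ?_ ?_ hc0 ?_ n
  · refine squeeze_zero_norm' (hl1.mono fun r hr1 => ?_)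
      (htend (2 * ‖J.ι‖ * G + 2 * ‖J.ι‖ * G))
    set f := ((a r)⁻¹ : ℂ) • resolvent T ((r : ℂ) * α) (z r) with hf
    have e : T f - α • f = ((r - 1 : ℝ) : ℂ) • (α • f) - ((a r)⁻¹ : ℂ) • z r := by
      rw [hf, map_smul, map_resolvent_apply (hmem ((r : ℂ) * α) (by rwa [hnorm r hr1]))]
      push_cast
      module
    have hfn : ‖f‖ ≤ 2 * ‖J.ι‖ * G := by
      refine (J.norm_le f).trans (mul_le_mul_of_nonneg_left ?_ (by positivity))
      have h := norm_le_norm_of_nonneg_of_le (J.abs_nonneg _) (hdom' r hr1)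
      rw [one_smul] at h
      exact h.trans (hgG r hr1)
    clear_value f
    rw [e]
    refine (norm_sub_le _ _).trans ?_
    rw [norm_smul, norm_smul, norm_smul, hα, one_mul, norm_inv, Complex.norm_real,
      Complex.norm_real, Real.norm_of_nonneg (ha0 r hr1).le,
      Real.norm_of_nonneg (by linarith : 0 ≤ r - 1)]
    have i1 := mul_le_mul_of_nonneg_left hfn (by linarith : 0 ≤ r - 1)
    have i2 := mul_le_of_le_one_right (inv_nonneg.2 (ha0 r hr1).le) (hz r)
    have i3 := hainv r hr1
    linarith
  · refine squeeze_zero_norm' (hl1.mono fun r hr1 => ?_)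
      (htend (G + 2 * ‖J.ι‖ * G * (2 * ‖J.re‖)))
    set g := (a r)⁻¹ • J.re (resolvent T (r : ℂ) (J.ι (J.abs (z r)))) with hg
    have e : S g - g = (r - 1) • g - (a r)⁻¹ • J.abs (z r) := by
      have hr' : 1 < ‖(r : ℂ)‖ := by
        rwa [Complex.norm_real, Real.norm_of_nonneg (by linarith)]
      rw [hg, map_smul, ← hTS, map_resolvent_apply (hmem (r : ℂ) hr'), map_sub, J.re_ι,
        Complex.coe_smul, map_smul]
      module
    have hgn : ‖g‖ ≤ G := hgG r hr1
    clear_value g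
    rw [e]
    refine (norm_sub_le _ _).trans ?_
    rw [norm_smul, norm_smul, norm_inv, Real.norm_of_nonneg (ha0 r hr1).le,
      Real.norm_of_nonneg (by linarith : 0 ≤ r - 1)]
    have i1 := mul_le_mul_of_nonneg_left hgn (by linarith : 0 ≤ r - 1)
    have i2 : ‖J.abs (z r)‖ ≤ 2 * ‖J.re‖ :=
      (J.norm_abs_le _).trans (mul_le_of_le_one_right (by positivity) (hz r))
    have i3 := mul_le_mul (hainv r hr1) i2 (norm_nonneg _)
      (mul_nonneg (by positivity) (by linarith))
    linarith
  · filter_upwards [hl1, hlc] with r hr1 hrc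
    rw [norm_smul, norm_inv, Complex.norm_real, Real.norm_of_nonneg (ha0 r hr1).le,
      ← div_eq_inv_mul, le_div_iff₀ (ha0 r hr1)]
    exact hzc r hr1 hrc

end Complexification

section LatticeGroup

variable {X : Type*} [AddCommGroup X] [Lattice X] [IsOrderedAddMonoid X]

theorem abs_add_abs_le_sup (x y : X) : |x| + |y| ≤ |x + y| ⊔ |x - y| := by
  change (x ⊔ -x) + (y ⊔ -y) ≤ _
  rw [sup_add, add_sup, add_sup]
  have h1 := le_abs_self (x + y)
  have h2 := le_abs_self (x - y)
  have h3 := neg_le_abs (x + y)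
  have h4 := neg_le_abs (x - y)
  rw [neg_add] at h3
  rw [neg_sub, sub_eq_neg_add] at h4
  rw [sub_eq_add_neg] at h2
  exact sup_le (sup_le (h1.trans le_sup_left) (by simpa [sub_eq_add_neg] using h2.trans le_sup_right))
    (sup_le (by simpa [sub_eq_add_neg] using h4.trans le_sup_right) (h3.trans le_sup_left))

theorem abs_add_inf_abs_sub_le (x y : X) : |x + y| ⊓ |x - y| ≤ |(|x| - |y|)| := by
  let _ := AddCommGroup.toDistribLattice X
  have aux : ∀ a b : X, (a + b) ⊓ (a - b) ≤ |a| - |b| := fun a b => by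
    have : (a + b) ⊓ (a - b) = a - |b| := by
      change _ = a - (b ⊔ -b)
      rw [sub_eq_add_neg, sub_eq_add_neg, neg_sup, neg_neg, add_inf, inf_comm]
    rw [this]
    exact sub_le_sub_right (le_abs_self a) _
  have h1 := (aux x y).trans (le_abs_self _)
  have h2 := (aux (-x) y).trans (le_abs_self _)
  have h3 := (aux y x).trans (neg_le_abs (|x| - |y|) |>.trans' (by rw [neg_sub]))
  have h4 := (aux (-y) x).trans (neg_le_abs (|x| - |y|) |>.trans' (by rw [neg_sub, abs_neg]))
  rw [abs_neg] at h2
  change ((x + y) ⊔ -(x + y)) ⊓ ((x - y) ⊔ -(x - y)) ≤ _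
  rw [inf_sup_right, inf_sup_left, inf_sup_left]
  refine sup_le (sup_le h1 ?_) (sup_le ?_ ?_)
  · rwa [add_comm x y, neg_sub]
  · rw [show -(x + y) = -y - x by abel, show x - y = -y + x by abel, inf_comm]
    exact h4
  · rw [show -(x + y) = -x - y by abel, show -(x - y) = -x + y by abel, inf_comm]
    exact h2

end LatticeGroup

namespace ComplexBanachLattice

variable (E : Type*) [NormedAddCommGroup E] [NormedSpace ℂ E] [PartialOrder E]
  [ComplexBanachLattice E]

/-- The real part of a complex Banach lattice as a real subspace. -/
def realPart : Submodule ℝ E where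
  carrier := real
  zero_mem' := real_zero
  add_mem' := fun hx hy => real_add _ hx _ hy
  smul_mem' := fun c x hx => by
    rw [← Complex.coe_smul]
    exact real_smul c x hx

variable {E}

theorem isLUB_neg_pair {x y s : E} (h : IsLUB {-x, -y} s) : IsGLB {x, y} (-s) := by
  have hneg : ∀ a b : E, -a ≤ b ↔ -b ≤ a := fun a b => by
    rw [le_iff_sub_nonneg, le_iff_sub_nonneg (-b) a, sub_neg_eq_add, sub_neg_eq_add, add_comm]
  refine ⟨?_, fun b hb => ?_⟩
  · rintro a (rfl | rfl)
    · exact (hneg _ _).1 (h.1 (by simp))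
    · exact (hneg _ _).1 (h.1 (by simp))
  · have : s ≤ -b := h.2 (by
      rintro a (rfl | rfl)
      · exact (hneg _ _).1 (by simpa using hb (by simp))
      · exact (hneg _ _).1 (by simpa using hb (by simp)))
    rw [le_iff_sub_nonneg] at this ⊢
    rwa [sub_eq_add_neg, add_comm, ← sub_eq_add_neg] at this

theorem exists_isLUB_realPart (x y : realPart E) :
    ∃ s : realPart E, IsLUB {(x : E), (y : E)} (s : E) := by
  obtain ⟨s, hs, h⟩ := real_sup_exists (x : E) x.2 (y : E) y.2
  exact ⟨⟨s, hs⟩, h⟩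

theorem exists_isGLB_realPart (x y : realPart E) :
    ∃ s : realPart E, IsGLB {(x : E), (y : E)} (s : E) := by
  obtain ⟨s, h⟩ := exists_isLUB_realPart (-x) (-y)
  exact ⟨-s, isLUB_neg_pair (by simpa using h)⟩

instance : Lattice (realPart E) where
  sup x y := (exists_isLUB_realPart x y).choose
  le_sup_left x y := (exists_isLUB_realPart x y).choose_spec.1 (by simp)
  le_sup_right x y := (exists_isLUB_realPart x y).choose_spec.1 (by simp)
  sup_le x y b hx hy := (exists_isLUB_realPart x y).choose_spec.2 (by
    rintro _ (rfl | rfl)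
    exacts [hx, hy])
  inf x y := (exists_isGLB_realPart x y).choose
  inf_le_left x y := (exists_isGLB_realPart x y).choose_spec.1 (by simp)
  inf_le_right x y := (exists_isGLB_realPart x y).choose_spec.1 (by simp)
  le_inf b x y hx hy := (exists_isGLB_realPart x y).choose_spec.2 (by
    rintro _ (rfl | rfl)
    exacts [hx, hy])

theorem isLUB_coe_sup (x y : realPart E) : IsLUB {(x : E), (y : E)} ((x ⊔ y : realPart E) : E) :=
  (exists_isLUB_realPart x y).choose_spec

instance : IsOrderedAddMonoid (realPart E) where
  add_le_add_left x y h c := by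
    have h' : (x : E) ≤ y := h
    change (x : E) + c ≤ y + c
    rw [le_iff_sub_nonneg] at h' ⊢
    rwa [add_sub_add_right_eq_sub]

instance : IsOrderedModule ℝ (realPart E) :=
  IsOrderedModule.of_smul_nonneg fun a ha b hb => by
    change (0 : E) ≤ a • (b : E)
    rw [← Complex.coe_smul]
    exact ComplexBanachLattice.smul_nonneg a ha _ hb

theorem coe_abs (x : realPart E) : ((|x| : realPart E) : E) = modulus (x : E) :=
  (isLUB_coe_sup x (-x)).unique (modulus_isLUB _ x.2)

instance : HasSolidNorm (realPart E) where
  solid x y h := by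
    refine norm_mono (x : E) (y : E) ?_
    rw [← coe_abs, ← coe_abs]
    exact h

/-- The modulus as an element of the real part. -/
def realModulus (z : E) : realPart E := ⟨modulus z, nonneg_mem_real _ (modulus_nonneg z)⟩

theorem abs_add_abs_le_realModulus (x y : realPart E) :
    |x| + |y| ≤ (3 : ℝ) • realModulus ((x : E) + Complex.I • (y : E)) := by
  set m := realModulus ((x : E) + Complex.I • (y : E)) with hm
  have hmod : ∀ (c : ℂ) (z : E), ‖c‖ = 1 → modulus (c • z) = modulus z := fun c z hc => by
    rw [modulus_smul, hc]; simp
  have hsub : ∀ (a b : realPart E) (c : ℂ) (z : E), ‖c‖ = 1 → (a : E) = z + c • (b : E) →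
      |a| - |b| ≤ realModulus z := by
    intro a b c z hc h
    rw [sub_le_iff_le_add]
    change ((|a| : realPart E) : E) ≤ modulus z + ((|b| : realPart E) : E)
    rw [coe_abs, coe_abs, ← hmod c (b : E) hc, h]
    exact modulus_add_le _ _
  have hm2 : realModulus ((1 - Complex.I) • ((x : E) + Complex.I • (y : E))) ≤ m + m := by
    change modulus _ ≤ modulus _ + modulus _
    rw [sub_smul, sub_eq_add_neg, ← neg_smul, one_smul]
    refine (modulus_add_le _ _).trans_eq ?_
    rw [hmod (-Complex.I) _ (by simp)]
  have hII : Complex.I * Complex.I = -1 := Complex.I_mul_I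
  have h1 : |(|x| - |y|)| ≤ m := by
    refine abs_le'.2 ⟨hsub x y (-Complex.I) _ (by simp) (by module), ?_⟩
    rw [neg_sub]
    refine (hsub y x Complex.I (-Complex.I • ((x : E) + Complex.I • (y : E))) (by simp) ?_).trans ?_
    · rw [smul_add, smul_smul, neg_mul, hII]; module
    · exact (hmod (-Complex.I) _ (by simp)).le
  have e : (1 - Complex.I) • ((x : E) + Complex.I • (y : E)) =
      ((x + y : realPart E) : E) - Complex.I • ((x - y : realPart E) : E) := by
    rw [smul_add, smul_smul, sub_mul, hII, Submodule.coe_add, Submodule.coe_sub]; module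
  have h2 : |(|x + y| - |x - y|)| ≤ m + m := by
    rw [e] at hm2
    refine abs_le'.2 ⟨(hsub (x + y) (x - y) Complex.I _ (by simp) (by module)).trans hm2, ?_⟩
    rw [neg_sub]
    refine (hsub (x - y) (x + y) (-Complex.I) (Complex.I • (((x + y : realPart E) : E) -
      Complex.I • ((x - y : realPart E) : E))) (by simp) ?_).trans (le_trans ?_ hm2)
    · rw [smul_sub, smul_smul, hII]; module
    · exact (hmod Complex.I _ (by simp)).le
  calc |x| + |y| ≤ |x + y| ⊔ |x - y| := abs_add_abs_le_sup x y
    _ = |x + y| ⊓ |x - y| + |(|x + y| - |x - y|)| := by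
      rw [abs_sub_comm |x + y|, ← sup_sub_inf_eq_abs_sub |x + y| |x - y|, add_sub_cancel]
    _ ≤ m + (m + m) := add_le_add ((abs_add_inf_abs_sub_le x y).trans h1) h2
    _ = (3 : ℝ) • m := by module

theorem decomp_unique {x y x' y' : realPart E}
    (h : (x : E) + Complex.I • (y : E) = x' + Complex.I • (y' : E)) : x = x' ∧ y = y' := by
  have h0 : ((x - x' : realPart E) : E) + Complex.I • ((y - y' : realPart E) : E) = 0 := by
    rw [Submodule.coe_sub, Submodule.coe_sub, smul_sub, ← sub_eq_zero.2 h]; abel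
  have h1 := abs_add_abs_le_realModulus (x - x') (y - y')
  have h2 : realModulus (0 : E) = 0 := Subtype.ext ((modulus_eq_zero_iff _).2 rfl)
  rw [h0, h2, smul_zero] at h1
  have hx := abs_nonneg (x - x')
  have hy := abs_nonneg (y - y')
  have hx0 : |x - x'| = 0 := le_antisymm ((le_add_of_nonneg_right hy).trans h1) hx
  have hy0 : |y - y'| = 0 := le_antisymm ((le_add_of_nonneg_left hx).trans h1) hy
  rw [← norm_eq_zero, norm_abs_eq_norm, norm_eq_zero, sub_eq_zero] at hx0 hy0
  exact ⟨hx0, hy0⟩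

theorem exists_decomp (z : E) : ∃ x : realPart E, ∃ y : realPart E,
    z = x + Complex.I • (y : E) := by
  obtain ⟨x, hx, y, hy, h⟩ := real_decomp z
  exact ⟨⟨x, hx⟩, ⟨y, hy⟩, h⟩

/-- The real part of an element. -/
def rePart (z : E) : realPart E := (exists_decomp z).choose

theorem rePart_add_I_smul (x y : realPart E) : rePart ((x : E) + Complex.I • (y : E)) = x :=
  (decomp_unique (exists_decomp ((x : E) + Complex.I • (y : E))).choose_spec.choose_spec).1.symm

theorem norm_rePart_le (z : E) : ‖rePart z‖ ≤ 3 * ‖z‖ := by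
  obtain ⟨x, y, rfl⟩ := exists_decomp z
  rw [rePart_add_I_smul, ← norm_abs_eq_norm x]
  have h := (le_add_of_nonneg_right (abs_nonneg y)).trans (abs_add_abs_le_realModulus x y)
  refine (norm_le_norm_of_nonneg_of_le (abs_nonneg x) h).trans_eq ?_
  rw [norm_smul, Real.norm_of_nonneg (by norm_num)]
  congr 1
  exact norm_modulus _

/-- The real part as a bounded operator. -/
def reCLM : E →L[ℝ] realPart E :=
  LinearMap.mkContinuous
    { toFun := rePart
      map_add' := fun z w => by
        obtain ⟨x, y, rfl⟩ := exists_decomp z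
        obtain ⟨x', y', rfl⟩ := exists_decomp w
        rw [rePart_add_I_smul, rePart_add_I_smul, ← rePart_add_I_smul (x + x') (y + y')]
        congr 1
        rw [Submodule.coe_add, Submodule.coe_add, smul_add]
        abel
      map_smul' := fun c z => by
        obtain ⟨x, y, rfl⟩ := exists_decomp z
        rw [rePart_add_I_smul, RingHom.id_apply, ← rePart_add_I_smul (c • x) (c • y)]
        congr 1
        rw [Submodule.coe_smul, Submodule.coe_smul, smul_add, smul_comm c] }
    3 norm_rePart_le

theorem reCLM_apply (z : E) : reCLM z = rePart z := rfl

theorem rePart_coe (x : realPart E) : rePart (x : E) = x := by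
  simpa using rePart_add_I_smul x 0

variable (E) in
/-- A complex Banach lattice is the complexification of its real part. -/
def complexification : Complexification (realPart E) E where
  ι := (realPart E).subtypeL
  re := reCLM
  re_ι := rePart_coe
  re_I_smul_ι x := by
    have := rePart_add_I_smul 0 x
    rwa [Submodule.coe_zero, zero_add] at this
  ι_re_add z := by
    obtain ⟨x, y, rfl⟩ := exists_decomp z
    have e : Complex.I • ((x : E) + Complex.I • (y : E)) =
        ((-y : realPart E) : E) + Complex.I • (x : E) := by
      rw [smul_add, smul_smul, Complex.I_mul_I, Submodule.coe_neg]; module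
    rw [e, reCLM_apply, reCLM_apply, rePart_add_I_smul, rePart_add_I_smul]
    simp

instance [CompleteSpace E] : CompleteSpace (realPart E) := by
  have hcl : IsClosed ((realPart E : Submodule ℝ E) : Set E) := by
    have : ((realPart E : Submodule ℝ E) : Set E) = {z : E | ((reCLM z : realPart E) : E) = z} := by
      ext z
      refine ⟨fun hz => congrArg Subtype.val (rePart_coe ⟨z, hz⟩), fun hz => ?_⟩
      rw [← (show ((reCLM z : realPart E) : E) = z from hz)]
      exact (reCLM z).2
    rw [this]
    exact isClosed_eq (continuous_subtype_val.comp reCLM.continuous) continuous_id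
  exact hcl.completeSpace_coe

theorem map_mem_realPart {T : E →L[ℂ] E} (hT : IsPositiveOp T) (x : realPart E) :
    T x ∈ realPart E := by
  have h : (x : E) = ((x⁺ : realPart E) : E) - ((x⁻ : realPart E) : E) := by
    rw [← Submodule.coe_sub, posPart_sub_negPart]
  have hpos : ∀ y : realPart E, 0 ≤ y → T y ∈ realPart E := fun y hy =>
    nonneg_mem_real _ (hT _ hy)
  rw [h, map_sub]
  exact sub_mem (hpos _ (posPart_nonneg x)) (hpos _ (negPart_nonneg x))

/-- The restriction of a positive operator to the real part. -/
def restrictReal (T : E →L[ℂ] E) (hT : IsPositiveOp T) : realPart E →L[ℝ] realPart E :=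
  ((T.restrictScalars ℝ).comp (realPart E).subtypeL).codRestrict (realPart E)
    (map_mem_realPart hT)

end ComplexBanachLattice

/-- **Theorem 7.8.** Let `T` be a positive operator on a complex Banach lattice `E` with
`r(T) = 1` and let `e^{iθ}` be a peripheral spectral value of `T`. If
`limsup_{r↓1} ‖R(re^{iθ},T)‖ / ‖R(r,T)‖ > 0`, then `e^{inθ} ∈ σ(T)` for each `n ∈ ℤ`. -/
theorem resolvent_growth_implies_cyclic_orbit_in_spectrum
    {E : Type*} [NormedAddCommGroup E] [NormedSpace ℂ E] [CompleteSpace E] [PartialOrder E]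
    [ComplexBanachLattice E]
    (T : E →L[ℂ] E) (hT : IsPositiveOp T)
    (hr : spectralRadius ℂ T = 1)
    (θ : ℝ) (hθ : Complex.exp (θ * Complex.I) ∈ spectrum ℂ T)
    (hlim : 0 < Filter.limsup
        (fun r : ℝ =>
          ‖resolvent T ((r : ℂ) * Complex.exp (θ * Complex.I))‖ / ‖resolvent T ((r : ℝ) : ℂ)‖)
        (nhdsWithin 1 (Set.Ioi 1))) :
    ∀ n : ℤ, Complex.exp ((n : ℂ) * θ * Complex.I) ∈ spectrum ℂ T := by
  intro n
  rw [mul_assoc, Complex.exp_int_mul]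
  refine (ComplexBanachLattice.complexification E).zpow_mem_spectrum_of_limsup_resolvent_pos
    (S := ComplexBanachLattice.restrictReal T hT) (fun x hx => hT _ hx) (fun z => ?_)
    (fun x => rfl) hr (Complex.norm_exp_ofReal_mul_I θ) hθ hlim n
  obtain ⟨x, y, rfl⟩ := ComplexBanachLattice.exists_decomp z
  change ComplexBanachLattice.rePart _ =
    ComplexBanachLattice.restrictReal T hT (ComplexBanachLattice.rePart _)
  rw [ComplexBanachLattice.rePart_add_I_smul, map_add, map_smul]
  exact ComplexBanachLattice.rePart_add_I_smul (ComplexBanachLattice.restrictReal T hT x)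
    (ComplexBanachLattice.restrictReal T hT y)

end
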